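/- arXiv:0802.2528 — 3 statements merged into one kernel-verified Lean document; each statement's English description precedes it below -/
import Mathlib

section
/- Let G be a 2-vertex-connected graph with nonnegative edge costs and a set S of at least 2 terminals with positive weights. Then G contains a simple cycle X containing at least 2 terminals such that density(X) ≤ density(G), where density of a subgraph is the total cost of its edges divided by the total weight of terminals among its vertices. -/
open SimpleGraph

/-- A graph is 2-vertex-connected: at least 3 vertices and deleting any single
vertex leaves a connected graph. -/
def Graph2Conn {V : Type*} (G : SimpleGraph V) : Prop :=
  3 ≤ Nat.card V ∧ ∀ v : V, (G.induce {w | w ≠ v}).Connected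

/-- Total edge cost of a walk. -/
def wcost {V : Type*} {G : SimpleGraph V} (c : Sym2 V → ℝ) {a b : V}
    (W : G.Walk a b) : ℝ :=
  (W.edges.map c).sum


open Finset

section Walks

variable {V : Type*} {G : SimpleGraph V}

@[simp] lemma wcost_nil (c : Sym2 V → ℝ) (a : V) : wcost c (Walk.nil : G.Walk a a) = 0 := by
  simp [wcost]

@[simp] lemma wcost_cons (c : Sym2 V → ℝ) {a b d : V} (h : G.Adj a b) (p : G.Walk b d) :
    wcost c (Walk.cons h p) = c s(a, b) + wcost c p := by
  simp [wcost]

@[simp] lemma wcost_append (c : Sym2 V → ℝ) {a b d : V} (p : G.Walk a b) (q : G.Walk b d) :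
    wcost c (p.append q) = wcost c p + wcost c q := by
  simp [wcost]

@[simp] lemma wcost_reverse (c : Sym2 V → ℝ) {a b : V} (p : G.Walk a b) :
    wcost c p.reverse = wcost c p := by
  simp [wcost, List.sum_reverse]

@[simp] lemma wcost_concat (c : Sym2 V → ℝ) {a b d : V} (p : G.Walk a b) (h : G.Adj b d) :
    wcost c (p.concat h) = wcost c p + c s(b, d) := by
  simp [Walk.concat_eq_append]

lemma wcost_nonneg {c : Sym2 V → ℝ} (hc : ∀ e, 0 ≤ c e) {a b : V} (p : G.Walk a b) :
    0 ≤ wcost c p := by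
  induction p with
  | nil => simp
  | cons h p ih => simpa using add_nonneg (hc _) ih

lemma wcost_eq_sum_edges [DecidableEq V] (c : Sym2 V → ℝ) {a b : V} {p : G.Walk a b}
    (hp : p.IsTrail) : wcost c p = ∑ e ∈ p.edges.toFinset, c e := by
  rw [List.sum_toFinset _ hp.edges_nodup, wcost]

lemma wcost_le_sum_of_isTrail [DecidableEq V] {c : Sym2 V → ℝ} (hc : ∀ e, 0 ≤ c e) {a b : V}
    {p : G.Walk a b} (hp : p.IsTrail) {F : Finset (Sym2 V)} (hF : ∀ e ∈ p.edges, e ∈ F) :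
    wcost c p ≤ ∑ e ∈ F, c e := by
  rw [wcost_eq_sum_edges c hp]
  exact sum_le_sum_of_subset_of_nonneg (fun e he ↦ hF e (by simpa using he)) fun e _ _ ↦ hc e

lemma SimpleGraph.Walk.IsPath.append_of_inter {a b d : V} {p : G.Walk a b} {q : G.Walk b d}
    (hp : p.IsPath) (hq : q.IsPath) (h : ∀ z ∈ p.support, z ∈ q.support → z = b) :
    (p.append q).IsPath := by
  rw [Walk.isPath_def, Walk.support_append, List.nodup_append']
  refine ⟨hp.support_nodup, hq.support_nodup.tail, fun z hz hz' ↦ ?_⟩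
  obtain rfl := h z hz (List.mem_of_mem_tail hz')
  have := hq.support_nodup
  rw [← Walk.cons_tail_support, List.nodup_cons] at this
  exact this.1 hz'

lemma SimpleGraph.Walk.IsPath.one_lt_length {a b t : V} {p : G.Walk a b} (ht : t ∈ p.support)
    (hta : t ≠ a) (htb : t ≠ b) : 1 < p.length := by
  match p with
  | .nil => simp_all
  | .cons _ .nil => simp_all
  | .cons _ (.cons _ _) => simp

lemma isCycle_append_of_inter {u v t : V} {p : G.Walk u v} {q : G.Walk v u}
    (hp : p.IsPath) (hq : q.IsPath) (h : ∀ z ∈ p.support, z ∈ q.support → z = u ∨ z = v)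
    (ht : t ∈ p.support) (htu : t ≠ u) (htv : t ≠ v) : (p.append q).IsCycle := by
  refine hp.isCycle_append hq (fun z hz hz' ↦ ?_)
    (.inl (Walk.IsPath.one_lt_length ht htu htv))
  have hp' := hp.support_nodup
  have hq' := hq.support_nodup
  rw [← Walk.cons_tail_support, List.nodup_cons] at hp' hq'
  rcases h z (List.mem_of_mem_tail hz) (List.mem_of_mem_tail hz') with rfl | rfl
  · exact hp'.1 hz
  · exact hq'.1 hz'

/-- A walk reaching `A` can be cut down to a path whose only vertex in `A` is its last one. -/
lemma exists_isPath_first_hit {a b : V} (p : G.Walk a b) (A : Set V) (hb : b ∈ A) :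
    ∃ z ∈ A, ∃ q : G.Walk a z, q.IsPath ∧ q.support ⊆ p.support ∧
      ∀ y ∈ q.support, y ∈ A → y = z := by
  classical
  suffices H : ∃ z ∈ A, ∃ q : G.Walk a z, q.support ⊆ p.support ∧
      ∀ y ∈ q.support, y ∈ A → y = z by
    obtain ⟨z, hz, q, hq, hA⟩ := H
    have hs : q.bypass.support ⊆ q.support := q.support_bypass_subset_support
    exact ⟨z, hz, q.bypass, q.bypass_isPath, fun y hy ↦ hq (hs hy), fun y hy ↦ hA y (hs hy)⟩
  induction p with
  | nil => exact ⟨_, hb, Walk.nil, by simp, by simp⟩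
  | @cons a d b h p ih =>
    by_cases ha : a ∈ A
    · exact ⟨a, ha, Walk.nil, by simp, by simp⟩
    obtain ⟨z, hz, q, hq, hA⟩ := ih hb
    refine ⟨z, hz, Walk.cons h q, ?_, ?_⟩
    · simp only [Walk.support_cons]
      exact List.cons_subset_cons _ hq
    · intro y hy hyA
      rw [Walk.support_cons, List.mem_cons] at hy
      rcases hy with rfl | hy
      · exact absurd hyA ha
      · exact hA y hy hyA

lemma exists_walk_of_induce_connected {s : Set V} (h : (G.induce s).Connected) {a b : V}
    (ha : a ∈ s) (hb : b ∈ s) : ∃ p : G.Walk a b, ∀ z ∈ p.support, z ∈ s := by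
  obtain ⟨p⟩ := h.preconnected ⟨a, ha⟩ ⟨b, hb⟩
  refine ⟨p.map (Embedding.induce s).toHom, fun z hz ↦ ?_⟩
  obtain ⟨y, -, rfl⟩ := List.mem_map.1 ((Walk.support_map _ p) ▸ hz)
  exact y.2

lemma induce_connected_of_exists_walk {s : Set V} {r : V} (hr : r ∈ s)
    (h : ∀ a ∈ s, ∃ p : G.Walk a r, ∀ z ∈ p.support, z ∈ s) : (G.induce s).Connected := by
  have key : ∀ a : s, (G.induce s).Reachable a ⟨r, hr⟩ := fun a ↦ by
    obtain ⟨p, hp⟩ := h a a.2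
    exact ⟨p.induce s hp⟩
  exact { preconnected := fun a b ↦ (key a).trans (key b).symm, nonempty := ⟨⟨r, hr⟩⟩ }

lemma Graph2Conn.exists_walk (hG : Graph2Conn G) {x a b : V} (ha : a ≠ x) (hb : b ≠ x) :
    ∃ p : G.Walk a b, x ∉ p.support := by
  obtain ⟨p, hp⟩ := exists_walk_of_induce_connected (hG.2 x) (a := a) (b := b) ha hb
  exact ⟨p, fun h ↦ hp x h rfl⟩

lemma Graph2Conn.exists_third [Fintype V] (hG : Graph2Conn G) (a b : V) :
    ∃ z, z ≠ a ∧ z ≠ b := by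
  classical
  have h : ({a, b} : Finset V).card < (univ : Finset V).card := by
    have := hG.1
    rw [Nat.card_eq_fintype_card] at this
    exact card_le_two.trans_lt (by rw [card_univ]; omega)
  obtain ⟨z, -, hz⟩ := exists_mem_notMem_of_card_lt_card h
  exact ⟨z, by simpa using hz⟩

/-- Two paths from `t` to distinct vertices of `A` that meet only in `t`. -/
def HasFan (G : SimpleGraph V) (A : Set V) (t : V) : Prop :=
  ∃ u ∈ A, ∃ v ∈ A, u ≠ v ∧ ∃ (p : G.Walk t u) (q : G.Walk t v), p.IsPath ∧ q.IsPath ∧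
    ∀ z ∈ p.support, z ∈ q.support → z = t

lemma HasFan.of_hit {A : Set V} {x y z u v : V} (hu : u ∈ A) (hv : v ∈ A) (huv : u ≠ v)
    {p : G.Walk x u} {q : G.Walk x v} (hp : p.IsPath) (hq : q.IsPath)
    (hpq : ∀ z ∈ p.support, z ∈ q.support → z = x) (hxy : G.Adj y x)
    {r : G.Walk y z} (hr : r.IsPath) (hxr : x ∉ r.support) (hyq : y ∉ q.support)
    (hzp : z ∈ p.support) (hrp : ∀ a ∈ r.support, a ∈ p.support → a = z)
    (hrq : ∀ a ∈ r.support, a ∈ q.support → a = z) : HasFan G A y := by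
  classical
  have hzx : z ≠ x := by rintro rfl; exact hxr (by simp)
  have hzq : z ∉ q.support := fun h ↦ hzx (hpq z hzp h)
  have hdrop : (p.dropUntil z hzp).support ⊆ p.support := p.support_dropUntil_subset_support hzp
  have hxd : x ∉ (p.dropUntil z hzp).support := fun hx ↦ by
    rw [← p.take_spec hzp] at hp
    exact Walk.IsPath.ne_of_mem_support_of_append (v := z) (p := (p.dropUntil z hzp).reverse)
      (q := (p.takeUntil z hzp).reverse) (by rw [← Walk.reverse_append]; exact hp.reverse)
      (x := x) (y := x) hzx.symm (by simpa using hx) (by simp) rfl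
  refine ⟨u, hu, v, hv, huv, r.append (p.dropUntil z hzp), Walk.cons hxy q,
    hr.append_of_inter (hp.dropUntil hzp) fun a ha ha' ↦ hrp a ha (hdrop ha'),
    (Walk.cons_isPath_iff _ _).2 ⟨hq, hyq⟩, fun a ha ha' ↦ ?_⟩
  rw [Walk.support_cons, List.mem_cons] at ha'
  rcases ha' with rfl | ha'
  · rfl
  rw [Walk.mem_support_append_iff] at ha
  rcases ha with ha | ha
  · obtain rfl := hrq a ha ha'
    exact absurd ha' hzq
  · obtain rfl := hpq a (hdrop ha) ha'
    exact absurd ha hxd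

lemma HasFan.of_adj (hG : Graph2Conn G) {A : Set V} {x y : V} (h : HasFan G A x)
    (hxy : G.Adj y x) : HasFan G A y := by
  obtain ⟨u, hu, v, hv, huv, p, q, hp, hq, hpq⟩ := h
  have hqp : ∀ z ∈ q.support, z ∈ p.support → z = x := fun z hz hz' ↦ hpq z hz' hz
  by_cases hyp : y ∈ p.support
  · have hyq : y ∉ q.support := fun h ↦ hxy.ne (hpq y hyp h)
    exact HasFan.of_hit hu hv huv hp hq hpq hxy (r := Walk.nil) (by simp) (by simpa using hxy.ne')
      hyq hyp (by simp) (by simp)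
  by_cases hyq : y ∈ q.support
  · exact HasFan.of_hit hv hu huv.symm hq hp hqp hxy (r := Walk.nil) (by simp)
      (by simpa using hxy.ne') hyp hyq (by simp) (by simp)
  obtain ⟨b, hbA, hbx⟩ : ∃ b ∈ A, b ≠ x := by
    by_cases hux : u = x
    · exact ⟨v, hv, fun h ↦ huv (hux.trans h.symm)⟩
    · exact ⟨u, hu, hux⟩
  obtain ⟨r₀, hr₀⟩ := hG.exists_walk hxy.ne hbx
  obtain ⟨z, hz, r, hr, hrr, hrz⟩ :=
    exists_isPath_first_hit r₀ (A ∪ {a | a ∈ p.support ∨ a ∈ q.support}) (.inl hbA)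
  have hxr : x ∉ r.support := fun h ↦ hr₀ (hrr h)
  have hrp : ∀ a ∈ r.support, a ∈ p.support → a = z := fun a ha h ↦ hrz a ha (.inr (.inl h))
  have hrq : ∀ a ∈ r.support, a ∈ q.support → a = z := fun a ha h ↦ hrz a ha (.inr (.inr h))
  by_cases hzp : z ∈ p.support
  · exact HasFan.of_hit hu hv huv hp hq hpq hxy hr hxr hyq hzp hrp hrq
  by_cases hzq : z ∈ q.support
  · exact HasFan.of_hit hv hu huv.symm hq hp hqp hxy hr hxr hyp hzq hrq hrp
  have hzA : z ∈ A := hz.resolve_right (by simp [hzp, hzq])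
  refine ⟨z, hzA, v, hv, fun h ↦ hzq (h ▸ q.end_mem_support), r, Walk.cons hxy q, hr,
    (Walk.cons_isPath_iff _ _).2 ⟨hq, hyq⟩, fun a ha ha' ↦ ?_⟩
  rw [Walk.support_cons, List.mem_cons] at ha'
  refine ha'.resolve_right fun h ↦ hzq ?_
  rwa [← hrq a ha h]

lemma Graph2Conn.hasFan [Fintype V] (hG : Graph2Conn G) {A : Set V} {a b t : V} (ha : a ∈ A)
    (hb : b ∈ A) (hab : a ≠ b) (ht : t ∉ A) : HasFan G A t := by
  obtain ⟨x, hxt, hxa⟩ := hG.exists_third t a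
  obtain ⟨p, -⟩ := hG.exists_walk hxt.symm hxa.symm
  clear hxt hxa
  suffices H : ∀ {y d : V} (p : G.Walk y d), y ∉ A → d ∈ A → HasFan G A y from H p ht ha
  intro y d p hy hd
  induction p with
  | nil => exact absurd hd hy
  | @cons y d e h p ih =>
    by_cases hdA : d ∈ A
    · obtain ⟨b', hb', hbd⟩ : ∃ b' ∈ A, b' ≠ d := by
        by_cases had : a = d
        · exact ⟨b, hb, fun h ↦ hab (had.trans h.symm)⟩
        · exact ⟨a, ha, had⟩
      obtain ⟨q₀, hq₀⟩ := hG.exists_walk h.ne hbd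
      classical
      have hdq : d ∉ q₀.bypass.support := fun h ↦ hq₀ (q₀.support_bypass_subset_support h)
      refine ⟨d, hdA, b', hb', hbd.symm, Walk.cons h Walk.nil, q₀.bypass, by simp [h.ne],
        q₀.bypass_isPath, fun z hz hz' ↦ ?_⟩
      simp only [Walk.support_cons, Walk.support_nil, List.mem_cons, List.not_mem_nil,
        or_false] at hz
      exact hz.resolve_right fun h ↦ hdq (h ▸ hz')
    · exact (ih hdA hd).of_adj hG h

/-- Any vertex outside a set `A` with at least two elements is inside a path with both ends, and
no other vertices, in `A`. -/
lemma Graph2Conn.exists_ear [Fintype V] (hG : Graph2Conn G) {A : Set V} {a b t : V} (ha : a ∈ A)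
    (hb : b ∈ A) (hab : a ≠ b) (ht : t ∉ A) :
    ∃ u ∈ A, ∃ v ∈ A, u ≠ v ∧ ∃ (p : G.Walk t u) (q : G.Walk t v),
      (p.reverse.append q).IsPath ∧
      (∀ z ∈ p.support, z ∈ A → z = u) ∧ (∀ z ∈ q.support, z ∈ A → z = v) := by
  obtain ⟨u, hu, v, hv, huv, p, q, hp, hq, hpq⟩ := hG.hasFan ha hb hab ht
  obtain ⟨u', hu', p', hp', hpp, hpA⟩ := exists_isPath_first_hit p A hu
  obtain ⟨v', hv', q', hq', hqq, hqA⟩ := exists_isPath_first_hit q A hv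
  refine ⟨u', hu', v', hv', ?_, p', q', ?_, hpA, hqA⟩
  · rintro rfl
    exact ht (hpq u' (hpp p'.end_mem_support) (hqq q'.end_mem_support) ▸ hu')
  · exact hp'.reverse.append_of_inter hq' fun z hz hz' ↦ hpq z (hpp (by simpa using hz)) (hqq hz')

/-- Any two vertices of a 2-connected graph lie on a cycle. -/
lemma Graph2Conn.exists_isCycle [Fintype V] (hG : Graph2Conn G) {s t : V} (hst : s ≠ t) :
    ∃ (x : V) (X : G.Walk x x), X.IsCycle ∧ s ∈ X.support ∧ t ∈ X.support := by
  obtain ⟨s', hadj, hs't⟩ : ∃ s', G.Adj s s' ∧ s' ≠ t := by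
    obtain ⟨z, hzs, hzt⟩ := hG.exists_third s t
    obtain ⟨p, hp⟩ := hG.exists_walk hst hzt
    cases p with
    | nil => exact absurd rfl hzs
    | @cons _ d _ h p =>
      refine ⟨d, h, ?_⟩
      rintro rfl
      exact hp (by simp)
  have ht : t ∉ ({s, s'} : Set V) := by simp [hst.symm, hs't.symm]
  obtain ⟨u, hu, v, hv, huv, p, q, hpq, -, -⟩ :=
    hG.exists_ear (A := {s, s'}) (by simp) (by simp) hadj.ne ht
  have htu : t ≠ u := by rintro rfl; exact ht hu
  have htv : t ≠ v := by rintro rfl; exact ht hv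
  have hvu : G.Adj v u := by
    rcases hu with rfl | rfl <;> rcases hv with rfl | rfl
    · exact absurd rfl huv
    · exact hadj.symm
    · exact hadj
    · exact absurd rfl huv
  have htm : t ∈ (p.reverse.append q).support := by simp
  refine ⟨u, (p.reverse.append q).append hvu.toWalk,
    isCycle_append_of_inter hpq (Walk.IsPath.of_adj hvu) (fun z _ hz ↦ ?_) htm htu htv, ?_, ?_⟩
  · simpa [or_comm] using hz
  · rw [Walk.mem_support_append_iff]
    right
    rcases hu with rfl | rfl
    · simp
    · rcases hv with rfl | rfl
      · simp
      · exact absurd rfl huv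
  · rw [Walk.mem_support_append_iff]
    exact .inl htm

/-- Two distinct vertices split a cycle into two paths. -/
lemma SimpleGraph.Walk.IsCycle.exists_arcs {x u v : V} {X : G.Walk x x} (hX : X.IsCycle)
    (hu : u ∈ X.support) (hv : v ∈ X.support) (huv : u ≠ v) (c : Sym2 V → ℝ) :
    ∃ A B : G.Walk v u, A.IsPath ∧ B.IsPath ∧ wcost c A + wcost c B = wcost c X ∧
      ∀ z, z ∈ X.support ↔ z ∈ A.support ∨ z ∈ B.support := by
  classical
  have hv' : v ∈ (X.rotate u hu).support := (X.mem_support_rotate_iff u hu).2 hv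
  have hspec := (X.rotate u hu).take_spec hv'
  have hcyc := hX.rotate hu
  have hB : ((X.rotate u hu).dropUntil v hv').IsPath := by
    rw [← hspec] at hcyc
    exact hcyc.isPath_of_append_right (Walk.not_nil_of_ne huv)
  refine ⟨((X.rotate u hu).takeUntil v hv').reverse, (X.rotate u hu).dropUntil v hv',
    (hcyc.isPath_takeUntil hv').reverse, hB, ?_, fun z ↦ ?_⟩
  · rw [wcost_reverse, ← wcost_append, hspec]
    exact ((X.rotate_edges u hu).perm.map c).sum_eq
  · have := congrArg (z ∈ ·.support) hspec
    simp only [Walk.mem_support_append_iff, X.mem_support_rotate_iff u hu] at this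
    simp [← this]

end Walks

section MinimumDensity

variable {V : Type*} [DecidableEq V] {G : SimpleGraph V}

/-- The total weight of the terminals on a walk. -/
def terminalWeight (S : Finset V) (w : V → ℝ) {a b : V} (p : G.Walk a b) : ℝ :=
  ∑ t ∈ S.filter (· ∈ p.support), w t

/-- A cycle through at least two terminals. -/
structure IsNontrivialCycle (S : Finset V) {x : V} (X : G.Walk x x) : Prop where
  isCycle : X.IsCycle
  exists_terminals : ∃ t1 ∈ S, ∃ t2 ∈ S, t1 ≠ t2 ∧ t1 ∈ X.support ∧ t2 ∈ X.support

/-- A nontrivial cycle whose density is minimum among all nontrivial cycles. -/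
structure IsMinDensityCycle (c : Sym2 V → ℝ) (S : Finset V) (w : V → ℝ) {x : V}
    (X : G.Walk x x) : Prop extends IsNontrivialCycle S X where
  le : ∀ {y : V} (Y : G.Walk y y), IsNontrivialCycle S Y →
    wcost c X * terminalWeight S w Y ≤ wcost c Y * terminalWeight S w X

lemma terminalWeight_nonneg {S : Finset V} {w : V → ℝ} (hw : ∀ s ∈ S, 0 < w s) {a b : V}
    (p : G.Walk a b) : 0 ≤ terminalWeight S w p :=
  sum_nonneg fun t ht ↦ (hw t (mem_filter.1 ht).1).le

lemma IsNontrivialCycle.terminalWeight_pos {S : Finset V} {w : V → ℝ} (hw : ∀ s ∈ S, 0 < w s)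
    {x : V} {X : G.Walk x x} (hX : IsNontrivialCycle S X) : 0 < terminalWeight S w X := by
  obtain ⟨t, ht, -, -, -, htX, -⟩ := hX.exists_terminals
  exact sum_pos (fun t ht ↦ hw t (mem_filter.1 ht).1) ⟨t, by simp [ht, htX]⟩

lemma Graph2Conn.exists_isMinDensityCycle [Fintype V] (hG : Graph2Conn G) (c : Sym2 V → ℝ)
    {S : Finset V} (hS : 2 ≤ S.card) {w : V → ℝ} (hw : ∀ s ∈ S, 0 < w s) :
    ∃ (x : V) (X : G.Walk x x), IsMinDensityCycle c S w X := by
  let P : Set (Finset (Sym2 V) × Finset V) := {a | ∃ (x : V) (X : G.Walk x x),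
    IsNontrivialCycle S X ∧ X.edges.toFinset = a.1 ∧ X.support.toFinset = a.2}
  let f : Finset (Sym2 V) × Finset V → ℝ := fun a ↦
    (∑ e ∈ a.1, c e) / ∑ t ∈ S.filter (· ∈ a.2), w t
  have hf : ∀ {x : V} (X : G.Walk x x), IsNontrivialCycle S X →
      f (X.edges.toFinset, X.support.toFinset) = wcost c X / terminalWeight S w X := by
    intro x X hX
    simp only [f, terminalWeight, List.mem_toFinset]
    rw [wcost_eq_sum_edges c hX.isCycle.isTrail]
  have hP : P.Nonempty := by
    obtain ⟨s, hs, t, ht, hst⟩ := one_lt_card.1 hS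
    obtain ⟨x, X, hX, hsX, htX⟩ := hG.exists_isCycle hst
    exact ⟨(X.edges.toFinset, X.support.toFinset), x, X, ⟨hX, s, hs, t, ht, hst, hsX, htX⟩, rfl, rfl⟩
  obtain ⟨⟨a, b⟩, ⟨x, X, hX, rfl, rfl⟩, hmin⟩ := P.exists_min_image f P.toFinite hP
  refine ⟨x, X, hX, fun {y} Y hY ↦ ?_⟩
  have := hmin (Y.edges.toFinset, Y.support.toFinset) ⟨y, Y, hY, rfl, rfl⟩
  rwa [hf X hX, hf Y hY, div_le_div_iff₀ (hX.terminalWeight_pos hw) (hY.terminalWeight_pos hw)]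
    at this

lemma IsMinDensityCycle.ear {c : Sym2 V → ℝ} (hc : ∀ e, 0 ≤ c e) {S : Finset V} {w : V → ℝ}
    (hw : ∀ s ∈ S, 0 < w s) {x : V} {X : G.Walk x x} (hX : IsMinDensityCycle c S w X)
    {u v t : V} (hu : u ∈ X.support) (hv : v ∈ X.support) (huv : u ≠ v) {Q : G.Walk u v}
    (hQ : Q.IsPath) (hQX : ∀ z ∈ Q.support, z ∈ X.support → z = u ∨ z = v)
    (htS : t ∈ S) (htQ : t ∈ Q.support) (htX : t ∉ X.support) :
    wcost c X * ∑ s ∈ S with s ∈ Q.support ∧ s ∉ X.support, w s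
      ≤ wcost c Q * terminalWeight S w X := by
  obtain ⟨A, B, hA, hB, hcost, hsupp⟩ := hX.isCycle.exists_arcs hu hv huv c
  have htu : t ≠ u := by rintro rfl; exact htX hu
  have htv : t ≠ v := by rintro rfl; exact htX hv
  have hcyc : ∀ D : G.Walk v u, D.IsPath → (∀ z ∈ D.support, z ∈ X.support) →
      (Q.append D).IsCycle := fun D hD hDX ↦
    isCycle_append_of_inter hQ hD (fun z hz hz' ↦ hQX z hz (hDX z hz')) htQ htu htv
  have hAX : ∀ z ∈ A.support, z ∈ X.support := fun z hz ↦ (hsupp z).2 (.inl hz)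
  have hBX : ∀ z ∈ B.support, z ∈ X.support := fun z hz ↦ (hsupp z).2 (.inr hz)
  have hXpos := hX.terminalWeight_pos hw
  -- an arc without terminals can be replaced by the ear
  have swap : ∀ D E : G.Walk v u, (∀ z ∈ S, z ∈ X.support → z ∈ D.support) →
      (Q.append D).IsCycle → wcost c D + wcost c E = wcost c X →
      wcost c X * ∑ s ∈ S with s ∈ Q.support ∧ s ∉ X.support, w s
        ≤ wcost c Q * terminalWeight S w X := by
    intro D E hD hQD hDE
    obtain ⟨t1, h1, t2, h2, h12, h1X, h2X⟩ := hX.exists_terminals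
    have hle := hX.le (Q.append D) ⟨hQD, t1, h1, t2, h2, h12,
      (Walk.mem_support_append_iff _ _).2 (.inr (hD t1 h1 h1X)),
      (Walk.mem_support_append_iff _ _).2 (.inr (hD t2 h2 h2X))⟩
    have hsum : terminalWeight S w X + ∑ s ∈ S with s ∈ Q.support ∧ s ∉ X.support, w s
        ≤ terminalWeight S w (Q.append D) := by
      simp only [terminalWeight, sum_filter, ← sum_add_distrib, Walk.mem_support_append_iff]
      refine sum_le_sum fun s hs ↦ ?_
      have := hw s hs
      have := hD s hs
      split_ifs <;> first | linarith | tauto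
    rw [wcost_append] at hle
    have := mul_le_mul_of_nonneg_left hsum (wcost_nonneg hc X)
    have := mul_nonneg (wcost_nonneg hc E) hXpos.le
    have : wcost c X * terminalWeight S w X =
      wcost c D * terminalWeight S w X + wcost c E * terminalWeight S w X := by
      rw [← hDE]; ring
    linarith
  by_cases hAS : ∃ s ∈ S, s ∈ A.support
  swap
  · push Not at hAS
    exact swap B A (fun z hz h ↦ ((hsupp z).1 h).resolve_left (hAS z hz)) (hcyc B hB hBX)
      (by rw [add_comm, hcost])
  by_cases hBS : ∃ s ∈ S, s ∈ B.support
  swap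
  · push Not at hBS
    exact swap A B (fun z hz h ↦ ((hsupp z).1 h).resolve_right (hBS z hz)) (hcyc A hA hAX) hcost
  have hle : ∀ D : G.Walk v u, D.IsPath → (∀ z ∈ D.support, z ∈ X.support) →
      (∃ s ∈ S, s ∈ D.support) → wcost c X * terminalWeight S w (Q.append D)
        ≤ wcost c (Q.append D) * terminalWeight S w X := by
    rintro D hD hDX ⟨s, hs, hsD⟩
    refine hX.le _ ⟨hcyc D hD hDX, t, htS, s, hs, ?_, ?_, ?_⟩
    · rintro rfl; exact htX (hDX _ hsD)
    · exact (Walk.mem_support_append_iff _ _).2 (.inl htQ)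
    · exact (Walk.mem_support_append_iff _ _).2 (.inr hsD)
  have h1 := hle A hA hAX hAS
  have h2 := hle B hB hBX hBS
  have hsum : terminalWeight S w X + 2 * ∑ s ∈ S with s ∈ Q.support ∧ s ∉ X.support, w s
      ≤ terminalWeight S w (Q.append A) + terminalWeight S w (Q.append B) := by
    simp only [terminalWeight, sum_filter, ← sum_add_distrib, Walk.mem_support_append_iff, mul_sum]
    refine sum_le_sum fun s hs ↦ ?_
    have := hw s hs
    have := hsupp s
    split_ifs <;> first | linarith | tauto
  rw [wcost_append] at h1 h2
  have := mul_le_mul_of_nonneg_left hsum (wcost_nonneg hc X)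
  have : wcost c X * terminalWeight S w X =
      wcost c A * terminalWeight S w X + wcost c B * terminalWeight S w X := by
    rw [← hcost]; ring
  linarith

end MinimumDensity

section Contraction

variable {V : Type*} {G : SimpleGraph V} {K : Finset V}

/-- The graph obtained from `G` by contracting the complement of `K` to the single vertex `none`. -/
def contractCompl (G : SimpleGraph V) (K : Finset V) : SimpleGraph (Option K) where
  Adj
    | some x, some y => G.Adj x y
    | some x, none => ∃ u ∉ K, G.Adj x u
    | none, some x => ∃ u ∉ K, G.Adj x u
    | none, none => False
  symm := ⟨by rintro (_ | x) (_ | y) h <;> first | exact h | exact G.symm.symm _ _ h⟩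
  loopless := ⟨by rintro (_ | x) h <;> first | exact h | exact G.loopless.irrefl _ h⟩

/-- Sends an edge of the contraction to an edge of the original graph, where `f x` is a chosen
neighbour of `x` outside `K`. -/
def contractEdge (K : Finset V) (f : V → V) (z : V) : Sym2 (Option K) → Sym2 V :=
  Sym2.lift ⟨fun
    | some x, some y => s(x, y)
    | some x, none => s(↑x, f x)
    | none, some x => s(↑x, f x)
    | none, none => s(z, z),
    by rintro (_ | x) (_ | y) <;> first | rfl | exact Sym2.eq_swap⟩

/-- `f` chooses for every vertex of `K` a neighbour outside `K`, whenever there is one. -/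
def IsExit (G : SimpleGraph V) (K : Finset V) (f : V → V) : Prop :=
  ∀ x ∈ K, (∃ u ∉ K, G.Adj x u) → f x ∉ K ∧ G.Adj x (f x)

lemma exists_isExit (G : SimpleGraph V) (K : Finset V) : ∃ f, IsExit G K f := by
  classical
  refine ⟨fun x ↦ if h : ∃ u ∉ K, G.Adj x u then h.choose else x, fun x _ h ↦ ?_⟩
  simp only [dif_pos h]
  exact h.choose_spec

lemma contractEdge_injOn {f : V → V} (hf : IsExit G K f) (z : V) :
    Set.InjOn (contractEdge K f z) (contractCompl G K).edgeSet := by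
  intro e he e' he' h
  induction e with | _ a b
  induction e' with | _ a' b'
  rw [mem_edgeSet] at he he'
  rcases a with _ | a <;> rcases b with _ | b <;> rcases a' with _ | a' <;> rcases b' with _ | b' <;>
    simp only [contractEdge, Sym2.lift_mk] at h <;>
    first
    | exact he.elim
    | exact he'.elim
    | skip
  all_goals
    try have hf1 := hf _ a.2
    try have hf2 := hf _ b.2
    try have hf3 := hf _ a'.2
    try have hf4 := hf _ b'.2
    simp only [contractCompl] at he he'
    simp only [Sym2.eq_iff, Option.some.injEq, Subtype.ext_iff, reduceCtorEq] at h ⊢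
    grind

lemma sum_contractEdge_le [Fintype V] [DecidableEq V] [DecidableRel G.Adj]
    [DecidableRel (contractCompl G K).Adj] {c : Sym2 V → ℝ} (hc : ∀ e, 0 ≤ c e) {f : V → V}
    (hf : IsExit G K f) (z : V) :
    ∑ e ∈ (contractCompl G K).edgeFinset, c (contractEdge K f z e)
      ≤ ∑ e ∈ G.edgeFinset with ∃ v ∈ K, v ∈ e, c e := by
  rw [← sum_image (g := contractEdge K f z) (f := c)
    (by simpa using contractEdge_injOn hf z)]
  refine sum_le_sum_of_subset_of_nonneg (fun e he ↦ ?_) fun e _ _ ↦ hc e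
  obtain ⟨e, he', rfl⟩ := mem_image.1 he
  rw [mem_edgeFinset] at he'
  induction e with | _ a b
  rw [mem_edgeSet] at he'
  rw [mem_filter, mem_edgeFinset]
  rcases a with _ | a <;> rcases b with _ | b <;> simp only [contractEdge, Sym2.lift_mk]
  · exact he'.elim
  · exact ⟨(hf _ b.2 he').2, b, b.2, by simp⟩
  · exact ⟨(hf _ a.2 he').2, a, a.2, by simp⟩
  · exact ⟨he', a, a.2, by simp⟩

lemma exists_contract_walk {x y : V} (p : G.Walk x y) (hp : ∀ z ∈ p.support, z ∈ K) (hx : x ∈ K)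
    (hy : y ∈ K) : ∃ q : (contractCompl G K).Walk (some ⟨x, hx⟩) (some ⟨y, hy⟩),
      none ∉ q.support := by
  induction p with
  | nil => exact ⟨Walk.nil, by simp⟩
  | @cons x d y h p ih =>
    have hd : d ∈ K := hp d (by simp)
    obtain ⟨q, hq⟩ := ih (fun z hz ↦ hp z (by simp [hz])) hd hy
    have h' : (contractCompl G K).Adj (some ⟨x, hx⟩) (some ⟨d, hd⟩) := h
    exact ⟨Walk.cons h' q, by simpa using hq⟩

lemma exists_contract_walk_to_none {x y a : V} (p : G.Walk x y) (ha : a ∈ K) (hp : a ∉ p.support)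
    (hx : x ∈ K) (hy : y ∉ K) : ∃ q : (contractCompl G K).Walk (some ⟨x, hx⟩) none,
      some ⟨a, ha⟩ ∉ q.support := by
  induction p with
  | nil => exact absurd hx hy
  | @cons x d y h p ih =>
    rw [Walk.support_cons, List.mem_cons, not_or] at hp
    by_cases hd : d ∈ K
    · obtain ⟨q, hq⟩ := ih hp.2 hd hy
      have h' : (contractCompl G K).Adj (some ⟨x, hx⟩) (some ⟨d, hd⟩) := h
      exact ⟨Walk.cons h' q, by simp [hq, hp.1]⟩
    · have h' : (contractCompl G K).Adj (some ⟨x, hx⟩) none := ⟨d, hd, h⟩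
      exact ⟨Walk.cons h' Walk.nil, by simp [hp.1]⟩

lemma Graph2Conn.contractCompl (hG : Graph2Conn G) (hK : 2 ≤ K.card) {b : V} (hb : b ∉ K)
    (hconn : ∀ x ∈ K, ∀ y ∈ K, ∃ p : G.Walk x y, ∀ z ∈ p.support, z ∈ K) :
    Graph2Conn (contractCompl G K) := by
  refine ⟨?_, ?_⟩
  · rw [Nat.card_eq_fintype_card, Fintype.card_option, Fintype.card_coe]
    omega
  rintro (_ | x)
  · obtain ⟨r, hr⟩ := card_pos.1 (by omega : 0 < K.card)
    refine induce_connected_of_exists_walk (r := some ⟨r, hr⟩) (by simp) ?_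
    rintro (_ | a) ha
    · exact absurd rfl ha
    obtain ⟨p, hp⟩ := hconn a a.2 r hr
    obtain ⟨q, hq⟩ := exists_contract_walk p hp a.2 hr
    exact ⟨q, fun z hz h ↦ hq (h ▸ hz)⟩
  · refine induce_connected_of_exists_walk (r := none) (by simp) ?_
    rintro (_ | a) ha
    · exact ⟨Walk.nil, by simp⟩
    obtain ⟨p, hp⟩ := hG.exists_walk (x := (x : V)) (a := a) (b := b)
      (fun h ↦ ha (congrArg some (Subtype.ext h))) (by rintro rfl; exact hb x.2)
    obtain ⟨q, hq⟩ := exists_contract_walk_to_none p x.2 hp a.2 hb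
    exact ⟨q, fun z hz h ↦ hq (h ▸ hz)⟩

/-- A path of the contraction avoiding `none` is a path of the original graph. -/
lemma exists_lift_path (c : Sym2 V → ℝ) (f : V → V) (z₀ : V) {a b : Option K}
    (p : (contractCompl G K).Walk a b) (hp : p.IsPath) (hnone : none ∉ p.support) {x y : K}
    (ha : a = some x) (hb : b = some y) :
    ∃ q : G.Walk x y, q.IsPath ∧ q.length = p.length ∧
      wcost c q = wcost (c ∘ contractEdge K f z₀) p ∧
      ∀ z, z ∈ q.support ↔ ∃ hz : z ∈ K, some ⟨z, hz⟩ ∈ p.support := by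
  induction p generalizing x with
  | nil =>
    subst ha
    obtain rfl : x = y := by simpa using hb
    exact ⟨Walk.nil, by simp, by simp, by simp, fun z ↦ by
      simp only [Walk.support_nil, List.mem_singleton, Option.some.injEq]
      exact ⟨fun h ↦ ⟨h ▸ x.2, Subtype.ext h⟩, fun ⟨_, h⟩ ↦ congrArg Subtype.val h⟩⟩
  | @cons a d b h p ih =>
    subst ha
    rw [Walk.support_cons, List.mem_cons, not_or] at hnone
    rw [Walk.cons_isPath_iff] at hp
    rcases d with _ | d
    · exact absurd p.start_mem_support hnone.2
    obtain ⟨q, hq, hlen, hcost, hsupp⟩ := ih hp.1 hnone.2 rfl hb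
    have h' : G.Adj x d := h
    refine ⟨Walk.cons h' q, ?_, by simp [hlen], ?_, fun z ↦ ?_⟩
    · rw [Walk.cons_isPath_iff, hsupp]
      exact ⟨hq, fun ⟨_, h⟩ ↦ hp.2 h⟩
    · rw [wcost_cons, wcost_cons, hcost]
      rfl
    · simp only [Walk.support_cons, List.mem_cons, hsupp, Option.some.injEq]
      constructor
      · rintro (rfl | ⟨hz, h⟩)
        · exact ⟨x.2, .inl rfl⟩
        · exact ⟨hz, .inr h⟩
      · rintro ⟨hz, h | h⟩
        · exact .inl (congrArg Subtype.val h)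
        · exact .inr ⟨hz, h⟩

/-- A cycle of the contraction gives a cycle of the original graph or a path with its ends, and no
other vertices, outside `K`. -/
lemma exists_lift_cycle (c : Sym2 V → ℝ) {f : V → V} (hf : IsExit G K f) (z₀ : V)
    {a : Option K} {Y : (contractCompl G K).Walk a a} (hY : Y.IsCycle) :
    (∃ (x : V) (Z : G.Walk x x), Z.IsCycle ∧ wcost c Z = wcost (c ∘ contractEdge K f z₀) Y ∧
      ∀ z (hz : z ∈ K), some ⟨z, hz⟩ ∈ Y.support → z ∈ Z.support) ∨
    ∃ u v : V, u ≠ v ∧ (u ∉ K ∧ ∃ x ∈ K, G.Adj x u) ∧ (v ∉ K ∧ ∃ x ∈ K, G.Adj x v) ∧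
      ∃ Q : G.Walk u v, Q.IsPath ∧ wcost c Q = wcost (c ∘ contractEdge K f z₀) Y ∧
      (∀ z ∈ Q.support, z = u ∨ z = v ∨ z ∈ K) ∧
      ∀ z (hz : z ∈ K), some ⟨z, hz⟩ ∈ Y.support → z ∈ Q.support := by
  classical
  by_cases hnone : none ∈ Y.support
  · obtain ⟨Y', hY', hcost, hsupp⟩ : ∃ Y' : (contractCompl G K).Walk none none, Y'.IsCycle ∧
        wcost (c ∘ contractEdge K f z₀) Y' = wcost (c ∘ contractEdge K f z₀) Y ∧
        ∀ z, z ∈ Y'.support ↔ z ∈ Y.support :=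
      ⟨Y.rotate none hnone, hY.rotate hnone, ((Y.rotate_edges none hnone).perm.map _).sum_eq,
        fun z ↦ Y.mem_support_rotate_iff none hnone⟩
    simp only [← hcost, ← hsupp]
    clear hcost hsupp hnone hY Y
    cases Y' with
    | nil => exact absurd rfl hY'.ne_nil
    | @cons _ b _ h p =>
    rw [Walk.cons_isCycle_iff] at hY'
    obtain ⟨hp, hedge⟩ := hY'
    obtain ⟨r, rfl⟩ : ∃ r, p = Walk.reverse r := ⟨p.reverse, by simp⟩
    rw [Walk.isPath_reverse_iff] at hp
    rw [Walk.edges_reverse, List.mem_reverse] at hedge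
    cases r with
    | nil => exact h.elim
    | @cons _ d _ h' p =>
    rw [Walk.cons_isPath_iff] at hp
    rcases b with _ | x
    · exact h.elim
    rcases d with _ | y
    · exact h'.elim
    obtain ⟨q, hq, -, hcost, hsupp⟩ := exists_lift_path c f z₀ p hp.1 hp.2 rfl rfl
    obtain ⟨hx, hx'⟩ := hf x x.2 h
    obtain ⟨hy, hy'⟩ := hf y y.2 h'
    have hxy : (x : V) ≠ y := fun hxy ↦ hedge (by simp [Subtype.ext hxy])
    have hqK : ∀ z ∈ q.support, z ∈ K := fun z hz ↦ ((hsupp z).1 hz).1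
    have hcost' : wcost (c ∘ contractEdge K f z₀)
        (Walk.cons h (Walk.cons h' p).reverse) = c s(↑x, f x) + (c s(↑y, f y) + wcost c q) := by
      rw [wcost_cons, wcost_reverse, wcost_cons, hcost]
      rfl
    have hR : (Walk.cons hy'.symm q).IsPath := (Walk.cons_isPath_iff _ _).2 ⟨hq, fun h ↦ hy (hqK _ h)⟩
    have hmem : ∀ z (hz : z ∈ K),
        some ⟨z, hz⟩ ∈ (Walk.cons h (Walk.cons h' p).reverse).support → z ∈ q.support := by
      intro z hz hzp
      rw [hsupp]
      refine ⟨hz, ?_⟩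
      simp only [Walk.support_cons, Walk.support_reverse, List.mem_cons, List.mem_reverse,
        reduceCtorEq, false_or] at hzp
      exact hzp
    by_cases hxyf : f x = f y
    · left
      have hxy' : G.Adj x (f y) := hxyf ▸ hx'
      refine ⟨x, Walk.cons hxy' (Walk.cons hy'.symm q), ?_, ?_, fun z hz h ↦ ?_⟩
      · rw [Walk.cons_isCycle_iff]
        refine ⟨hR, fun h ↦ ?_⟩
        rw [Walk.edges_cons, List.mem_cons] at h
        rcases h with h | h
        · grind
        · exact hy (hqK _ (q.snd_mem_support_of_mem_edges h))
      · rw [hcost', wcost_cons, wcost_cons, hxyf, Sym2.eq_swap (a := f y)]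
      · simp [hmem z hz h]
    · right
      refine ⟨f y, f x, Ne.symm hxyf, ⟨hy, y, y.2, hy'⟩, ⟨hx, x, x.2, hx'⟩,
        (Walk.cons hy'.symm q).concat hx', hR.concat ?_ hx', ?_, fun z hz ↦ ?_, fun z hz h ↦ ?_⟩
      · rw [Walk.support_cons, List.mem_cons]
        exact fun h ↦ h.elim hxyf fun h ↦ hx (hqK _ h)
      · rw [hcost', wcost_concat, wcost_cons, Sym2.eq_swap (a := f y)]
        ring
      · simp only [Walk.support_concat, Walk.support_cons, List.mem_append,
          List.mem_cons, List.not_mem_nil, or_false] at hz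
        rcases hz with (rfl | hz) | rfl
        · exact .inl rfl
        · exact .inr (.inr (hqK _ hz))
        · exact .inr (.inl rfl)
      · simp [Walk.support_concat, hmem z hz h]
  · left
    have hlen := hY.three_le_length
    rcases a with _ | x
    · exact absurd Y.start_mem_support hnone
    cases Y with
    | nil => exact absurd rfl hY.ne_nil
    | @cons _ d _ h p =>
    rw [Walk.support_cons, List.mem_cons, not_or] at hnone
    rw [Walk.cons_isCycle_iff] at hY
    rcases d with _ | d
    · exact absurd p.start_mem_support hnone.2
    obtain ⟨q, hq, hql, hcost, hsupp⟩ := exists_lift_path c f z₀ p hY.1 hnone.2 rfl rfl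
    have h' : G.Adj x d := h
    refine ⟨x, Walk.cons h' q, ?_, ?_, fun z hz hzY ↦ ?_⟩
    · rw [Walk.cons_isCycle_iff]
      refine ⟨hq, fun hmem ↦ ?_⟩
      have := hq.length_eq_one_of_mem_edges (Sym2.eq_swap (a := (x : V)) ▸ hmem)
      rw [Walk.length_cons] at hlen
      omega
    · rw [wcost_cons, wcost_cons, hcost]
      rfl
    · rw [Walk.support_cons, List.mem_cons] at hzY ⊢
      refine hzY.imp (fun h ↦ ?_) fun h ↦ (hsupp z).2 ⟨hz, h⟩
      exact congrArg Subtype.val (Option.some.inj h)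

/-- The terminals in `K`, as vertices of the contraction. -/
def contractTerminals [DecidableEq V] (K S : Finset V) : Finset (Option K) :=
  (S.subtype (· ∈ K)).map Function.Embedding.some

/-- The vertex weights of the contraction. -/
def contractWeight (K : Finset V) (w : V → ℝ) : Option K → ℝ
  | some x => w x
  | none => 0

lemma sum_contractTerminals [DecidableEq V] (K S : Finset V) (w : V → ℝ) :
    ∑ s ∈ contractTerminals K S, contractWeight K w s = ∑ s ∈ S with s ∈ K, w s := by
  simp only [contractTerminals, sum_map, Function.Embedding.some_apply, contractWeight]
  exact sum_subtype_eq_sum_filter w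

lemma terminalWeight_contract_le [DecidableEq V] {S : Finset V} {w : V → ℝ}
    (hw : ∀ s ∈ S, 0 < w s) {a b : Option K} (Y : (contractCompl G K).Walk a b) {P : V → Prop}
    [DecidablePred P] (hP : ∀ z (hz : z ∈ K), some ⟨z, hz⟩ ∈ Y.support → P z) :
    terminalWeight (contractTerminals K S) (contractWeight K w) Y ≤ ∑ s ∈ S with P s, w s := by
  rw [terminalWeight, sum_filter, contractTerminals, sum_map]
  calc _ ≤ ∑ x ∈ S.subtype (· ∈ K), if P x then w x else 0 := by
        refine sum_le_sum fun x hx ↦ ?_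
        have := hP x x.2
        have := hw x (mem_subtype.1 hx)
        simp only [Function.Embedding.some_apply, contractWeight]
        split_ifs <;> first | linarith | tauto
    _ = ∑ s ∈ S with s ∈ K, if P s then w s else 0 :=
        sum_subtype_eq_sum_filter fun x ↦ if P x then w x else 0
    _ ≤ ∑ s ∈ S, if P s then w s else 0 := by
        refine sum_le_sum_of_subset_of_nonneg (filter_subset _ _) fun x hx _ ↦ ?_
        have := hw x hx
        split_ifs <;> linarith
    _ = _ := (sum_filter _ _).symm

end Contraction

section ComponentUnion

variable {V : Type*} {G : SimpleGraph V}

/-- `K` is a union of connected components of `G` with the vertices in `A` deleted. -/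
def IsComponentUnion (G : SimpleGraph V) (A : Set V) (K : Finset V) : Prop :=
  ∀ x ∈ K, x ∉ A ∧ ∀ y ∉ A, G.Adj x y → y ∈ K

lemma IsComponentUnion.exists_mem_edge {A : Set V} {K : Finset V} (hK : IsComponentUnion G A K)
    {t u : V} {p : G.Walk t u} (hp : p.IsPath) (ht : t ∈ K)
    (hpA : ∀ z ∈ p.support, z ∈ A → z = u) {e : Sym2 V} (he : e ∈ p.edges) :
    ∃ v ∈ K, v ∈ e := by
  induction p with
  | nil => simp at he
  | @cons t d u h p ih =>
    rw [Walk.edges_cons, List.mem_cons] at he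
    rcases he with rfl | he
    · exact ⟨t, ht, by simp⟩
    rw [Walk.cons_isPath_iff] at hp
    by_cases hd : d ∈ A
    · obtain rfl := hpA d (by simp) hd
      rw [Walk.isPath_iff_nil, ← Walk.eq_nil_iff_nil] at hp
      simp [hp.1] at he
    · exact ih hp.1 ((hK t ht).2 d hd h) (fun z hz ↦ hpA z (by simp [hz])) he

variable [DecidableEq V]

/-- The total cost of the edges with an endpoint in `K`. -/
def touchCost [Fintype V] (G : SimpleGraph V) [DecidableRel G.Adj] (c : Sym2 V → ℝ)
    (K : Finset V) : ℝ :=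
  ∑ e ∈ G.edgeFinset with ∃ v ∈ K, v ∈ e, c e

lemma touchCost_union [Fintype V] [DecidableRel G.Adj] (c : Sym2 V → ℝ) {K L : Finset V}
    (h : ∀ x ∈ K, ∀ y ∈ L, x ≠ y ∧ ¬ G.Adj x y) :
    touchCost G c (K ∪ L) = touchCost G c K + touchCost G c L := by
  rw [touchCost, touchCost, touchCost, ← sum_union]
  · refine sum_congr ?_ fun _ _ ↦ rfl
    ext e
    simp only [mem_filter, mem_union]
    grind
  · rw [Finset.disjoint_left]
    intro e he he'
    rw [mem_filter, mem_edgeFinset] at he he'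
    obtain ⟨he, x, hx, hxe⟩ := he
    obtain ⟨-, y, hy, hye⟩ := he'
    obtain ⟨hxy, hadj⟩ := h x hx y hy
    rw [(Sym2.mem_and_mem_iff hxy).1 ⟨hxe, hye⟩] at he
    exact hadj he

/-- If a union of components satisfies a strict linear inequality between the cost of its edges and
the weight of its terminals, then so does a single component. -/
lemma IsComponentUnion.exists_connected [Fintype V] [DecidableRel G.Adj] {c : Sym2 V → ℝ}
    {A : Set V} {K₀ S : Finset V} (w : V → ℝ) {a b : ℝ} (hK₀ : IsComponentUnion G A K₀)
    (h₀ : touchCost G c K₀ * b < a * ∑ s ∈ S with s ∈ K₀, w s) :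
    ∃ K, IsComponentUnion G A K ∧
      (∀ x ∈ K, ∀ y ∈ K, ∃ p : G.Walk x y, ∀ z ∈ p.support, z ∈ K) ∧
      touchCost G c K * b < a * ∑ s ∈ S with s ∈ K, w s := by
  classical
  let P : Set (Finset V) := {K | IsComponentUnion G A K ∧
    touchCost G c K * b < a * ∑ s ∈ S with s ∈ K, w s}
  obtain ⟨K, ⟨hK, hlt⟩, hmin⟩ := P.exists_min_image card P.toFinite ⟨K₀, hK₀, h₀⟩
  refine ⟨K, hK, fun x hx ↦ ?_, hlt⟩
  by_contra hne
  push Not at hne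
  obtain ⟨y, hy, hxy⟩ := hne
  let R : V → Prop := fun y ↦ ∃ p : G.Walk x y, ∀ z ∈ p.support, z ∈ K
  have hR : ∀ u v, u ∈ K → v ∈ K → G.Adj u v → R u → R v := by
    rintro u v - hv huv ⟨p, hp⟩
    refine ⟨p.concat huv, fun z hz ↦ ?_⟩
    simp only [Walk.support_concat, List.mem_append, List.mem_singleton] at hz
    rcases hz with hz | rfl
    · exact hp z hz
    · exact hv
  have hxR : R x := ⟨Walk.nil, by simpa using hx⟩
  have hyR : ¬ R y := fun ⟨p, hp⟩ ↦ by obtain ⟨z, hz, hz'⟩ := hxy p; exact hz' (hp z hz)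
  have hunion : K.filter R ∪ K.filter (¬ R ·) = K := filter_union_filter_not_eq R K
  have hcost := touchCost_union (G := G) c (K := K.filter R) (L := K.filter (¬ R ·))
    fun u hu v hv ↦ by
      rw [mem_filter] at hu hv
      exact ⟨by rintro rfl; exact hv.2 hu.2, fun h ↦ hv.2 (hR u v hu.1 hv.1 h hu.2)⟩
  rw [hunion] at hcost
  have hsum : ∑ s ∈ S with s ∈ K, w s =
      (∑ s ∈ S with s ∈ K.filter R, w s) + ∑ s ∈ S with s ∈ K.filter (¬ R ·), w s := by
    simp only [sum_filter, ← sum_add_distrib, mem_filter]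
    refine sum_congr rfl fun s _ ↦ ?_
    by_cases s ∈ K <;> by_cases R s <;> simp [*]
  have h1 : ¬ K.filter R ∈ P := fun h ↦
    (card_lt_card (filter_ssubset.2 ⟨y, hy, hyR⟩)).not_ge (hmin _ h)
  have h2 : ¬ K.filter (¬ R ·) ∈ P := fun h ↦
    (card_lt_card (filter_ssubset.2 ⟨x, hx, not_not.2 hxR⟩)).not_ge (hmin _ h)
  have hc1 : IsComponentUnion G A (K.filter R) := fun u hu ↦ by
    rw [mem_filter] at hu
    refine ⟨(hK u hu.1).1, fun v hv huv ↦ ?_⟩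
    have hvK := (hK u hu.1).2 v hv huv
    exact mem_filter.2 ⟨hvK, hR u v hu.1 hvK huv hu.2⟩
  have hc2 : IsComponentUnion G A (K.filter (¬ R ·)) := fun u hu ↦ by
    rw [mem_filter] at hu
    refine ⟨(hK u hu.1).1, fun v hv huv ↦ ?_⟩
    have hvK := (hK u hu.1).2 v hv huv
    exact mem_filter.2 ⟨hvK, fun h ↦ hu.2 (hR v u hvK hu.1 huv.symm h)⟩
  have h1' := not_lt.1 fun h ↦ h1 ⟨hc1, h⟩
  have h2' := not_lt.1 fun h ↦ h2 ⟨hc2, h⟩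
  rw [hsum, hcost] at hlt
  linarith

lemma IsMinDensityCycle.lift_le [Fintype V] {c : Sym2 V → ℝ} (hc : ∀ e, 0 ≤ c e)
    {S : Finset V} {w : V → ℝ} (hw : ∀ s ∈ S, 0 < w s) {x : V} {X : G.Walk x x}
    (hX : IsMinDensityCycle c S w X) {K : Finset V}
    (hK : IsComponentUnion G {z | z ∈ X.support} K) {f : V → V} (hf : IsExit G K f) (z₀ : V)
    {a : Option K} {Y : (contractCompl G K).Walk a a}
    (hY : IsNontrivialCycle (contractTerminals K S) Y) :
    wcost c X * terminalWeight (contractTerminals K S) (contractWeight K w) Y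
      ≤ wcost (c ∘ contractEdge K f z₀) Y * terminalWeight S w X := by
  have hmem : ∀ t, t ∈ contractTerminals K S → ∃ s, ∃ hs : s ∈ K, s ∈ S ∧ t = some ⟨s, hs⟩ := by
    intro t ht
    obtain ⟨s, hs, rfl⟩ := mem_map.1 ht
    exact ⟨s, s.2, mem_subtype.1 hs, rfl⟩
  obtain ⟨t1, h1, t2, h2, h12, h1Y, h2Y⟩ := hY.exists_terminals
  obtain ⟨s1, hs1, hs1S, rfl⟩ := hmem t1 h1
  obtain ⟨s2, hs2, hs2S, rfl⟩ := hmem t2 h2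
  have hout : ∀ u, (u ∉ K ∧ ∃ x ∈ K, G.Adj x u) → u ∈ X.support := by
    rintro u ⟨hu, x, hx, hxu⟩
    by_contra h
    exact hu ((hK x hx).2 u h hxu)
  obtain ⟨y, Z, hZ, hcost, hZs⟩ | ⟨u, v, huv, hu, hv, Q, hQ, hcost, hQK, hQs⟩ :=
    exists_lift_cycle c hf z₀ hY.isCycle
  · have hle := hX.le Z ⟨hZ, s1, hs1S, s2, hs2S, fun h ↦ h12 (by simp [h]), hZs _ hs1 h1Y,
      hZs _ hs2 h2Y⟩
    rw [hcost] at hle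
    exact (mul_le_mul_of_nonneg_left (terminalWeight_contract_le hw Y hZs)
      (wcost_nonneg hc X)).trans hle
  · have hear := hX.ear hc hw (hout u hu) (hout v hv) huv hQ
      (fun z hz hzX ↦ by
        rcases hQK z hz with h | h | h
        · exact .inl h
        · exact .inr h
        · exact absurd hzX (hK z h).1) hs1S (hQs _ hs1 h1Y) (hK s1 hs1).1
    rw [hcost] at hear
    exact (mul_le_mul_of_nonneg_left (terminalWeight_contract_le hw Y
      fun z hz h ↦ ⟨hQs z hz h, (hK z hz).1⟩) (wcost_nonneg hc X)).trans hear

end ComponentUnion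

/-- A 2-connected graph has a nontrivial cycle of at most its own density. -/
theorem exists_isNontrivialCycle_density_le {V : Type*} [Fintype V] [DecidableEq V]
    (G : SimpleGraph V) [DecidableRel G.Adj] (hG : Graph2Conn G) (c : Sym2 V → ℝ)
    (hc : ∀ e, 0 ≤ c e) (S : Finset V) (hS : 2 ≤ S.card) (w : V → ℝ) (hw : ∀ s ∈ S, 0 < w s) :
    ∃ (x : V) (X : G.Walk x x), IsNontrivialCycle S X ∧
      wcost c X * ∑ t ∈ S, w t ≤ (∑ e ∈ G.edgeFinset, c e) * terminalWeight S w X := by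
  induction hn : Fintype.card V using Nat.strong_induction_on generalizing V with | _ n ih
  obtain ⟨x, X, hX⟩ := hG.exists_isMinDensityCycle c hS hw
  refine ⟨x, X, hX.1, ?_⟩
  by_contra! hlt
  have hXpos := hX.terminalWeight_pos hw
  have hcX := wcost_nonneg hc X
  obtain ⟨K, hK, hconn, hKlt⟩ : ∃ K, IsComponentUnion G {z | z ∈ X.support} K ∧
      (∀ x ∈ K, ∀ y ∈ K, ∃ p : G.Walk x y, ∀ z ∈ p.support, z ∈ K) ∧
      touchCost G c K * terminalWeight S w X < wcost c X * ∑ s ∈ S with s ∈ K, w s := by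
    have hK₀ : IsComponentUnion G {z | z ∈ X.support} (univ.filter (· ∉ X.support)) :=
      fun u hu ↦ ⟨by simpa using hu, fun v hv _ ↦ by simpa using hv⟩
    refine hK₀.exists_connected w ?_
    have hE : wcost c X + touchCost G c (univ.filter (· ∉ X.support))
        ≤ ∑ e ∈ G.edgeFinset, c e := by
      rw [wcost_eq_sum_edges c hX.isCycle.isTrail, touchCost, ← sum_union]
      · refine sum_le_sum_of_subset_of_nonneg (union_subset (fun e he ↦ ?_) (filter_subset _ _))
          fun e _ _ ↦ hc e
        exact mem_edgeFinset.2 (X.edges_subset_edgeSet (List.mem_toFinset.1 he))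
      · rw [Finset.disjoint_left]
        intro e he he'
        obtain ⟨-, v, hv, hve⟩ := mem_filter.1 he'
        exact (mem_filter.1 hv).2 (X.mem_support_of_mem_edges (List.mem_toFinset.1 he) hve)
    have hW : ∑ t ∈ S, w t = terminalWeight S w X +
        ∑ s ∈ S with s ∈ (univ.filter (· ∉ X.support) : Finset V), w s := by
      simp [terminalWeight, sum_filter_add_sum_filter_not]
    have := mul_le_mul_of_nonneg_right hE hXpos.le
    rw [hW] at hlt
    linarith
  obtain hcard | hcard | hcard : (S.filter (· ∈ K)).card = 0 ∨ (S.filter (· ∈ K)).card = 1 ∨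
      2 ≤ (S.filter (· ∈ K)).card := by omega
  · rw [card_eq_zero.1 hcard, sum_empty, mul_zero] at hKlt
    exact hKlt.not_ge (mul_nonneg (sum_nonneg fun e _ ↦ hc e) hXpos.le)
  · obtain ⟨t, ht⟩ := card_eq_one.1 hcard
    obtain ⟨htS, htK⟩ := mem_filter.1 (ht ▸ mem_singleton_self t)
    obtain ⟨a, -, b, -, hab, ha, hb⟩ := hX.exists_terminals
    obtain ⟨u, hu, v, hv, huv, p, q, hpq, hp, hq⟩ :=
      hG.exists_ear (A := {z | z ∈ X.support}) ha hb hab (hK t htK).1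
    have htQ : t ∈ (p.reverse.append q).support := by simp
    have hear := hX.ear hc hw hu hv huv hpq (fun z hz hzX ↦ by
      rw [Walk.mem_support_append_iff, Walk.support_reverse, List.mem_reverse] at hz
      exact hz.imp (hp z · hzX) (hq z · hzX)) htS htQ (hK t htK).1
    have hcost : wcost c (p.reverse.append q) ≤ touchCost G c K := by
      refine wcost_le_sum_of_isTrail hc hpq.isTrail fun e he ↦ ?_
      refine mem_filter.2 ⟨mem_edgeFinset.2 (Walk.edges_subset_edgeSet _ he), ?_⟩
      rw [Walk.edges_append, List.mem_append, Walk.edges_reverse, List.mem_reverse] at he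
      rcases he with he | he
      · exact hK.exists_mem_edge ((Walk.isPath_reverse_iff p).1 hpq.of_append_left) htK hp he
      · exact hK.exists_mem_edge hpq.of_append_right htK hq he
    have hsum : ∑ s ∈ S with s ∈ K, w s ≤
        ∑ s ∈ S with s ∈ (p.reverse.append q).support ∧ s ∉ X.support, w s := by
      rw [ht]
      refine sum_le_sum_of_subset_of_nonneg (singleton_subset_iff.2 ?_)
        fun s hs _ ↦ (hw s (mem_filter.1 hs).1).le
      exact mem_filter.2 ⟨htS, htQ, (hK t htK).1⟩
    have := mul_le_mul_of_nonneg_left hsum hcX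
    have := mul_le_mul_of_nonneg_right hcost hXpos.le
    linarith
  · classical
    obtain ⟨a, -, b, -, hab, ha, hb⟩ := hX.exists_terminals
    have haK : a ∉ K := fun h ↦ (hK a h).1 ha
    have hbK : b ∉ K := fun h ↦ (hK b h).1 hb
    have hK2 : 2 ≤ K.card := hcard.trans (card_le_card fun s hs ↦ (mem_filter.1 hs).2)
    have hlt' : Fintype.card (Option K) < n := by
      rw [Fintype.card_option, Fintype.card_coe, ← hn]
      have := card_le_univ (insert a (insert b K))
      rw [card_insert_of_notMem (by simp [hab, haK]), card_insert_of_notMem hbK] at this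
      omega
    obtain ⟨f, hf⟩ := exists_isExit G K
    obtain ⟨y, Y, hY, hYle⟩ := ih _ hlt' (contractCompl G K) (hG.contractCompl hK2 haK hconn)
      (c ∘ contractEdge K f x) (fun e ↦ hc _) (contractTerminals K S)
      (by rwa [contractTerminals, card_map, card_subtype]) (contractWeight K w)
      (fun t ht ↦ by
        obtain ⟨s, hs, rfl⟩ := mem_map.1 ht
        exact hw s (mem_subtype.1 hs)) rfl
    have hYpos : 0 < terminalWeight (contractTerminals K S) (contractWeight K w) Y :=
      hY.terminalWeight_pos fun t ht ↦ by
        obtain ⟨s, hs, rfl⟩ := mem_map.1 ht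
        exact hw s (mem_subtype.1 hs)
    have hlift := hX.lift_le hc hw hK hf x hY
    rw [sum_contractTerminals] at hYle
    have htouch : ∑ e ∈ (contractCompl G K).edgeFinset, (c ∘ contractEdge K f x) e
        ≤ touchCost G c K := sum_contractEdge_le hc hf x
    have hT : 0 ≤ ∑ s ∈ S with s ∈ K, w s := sum_nonneg fun s hs ↦ (hw s (mem_filter.1 hs).1).le
    have h1 := mul_le_mul_of_nonneg_right hlift hT
    have h2 := mul_le_mul_of_nonneg_right
      (hYle.trans (mul_le_mul_of_nonneg_right htouch hYpos.le)) hXpos.le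
    have h3 := mul_lt_mul_of_pos_right hKlt hYpos
    linarith

theorem two_connected_graph_has_nontrivial_cycle_of_average_density
    {V : Type*} [Fintype V] [DecidableEq V] (G : SimpleGraph V) [DecidableRel G.Adj]
    (hG : Graph2Conn G)
    (c : Sym2 V → ℝ) (hc : ∀ e, 0 ≤ c e)
    (S : Finset V) (hS : 2 ≤ S.card)
    (w : V → ℝ) (hw : ∀ s ∈ S, 0 < w s) :
    ∃ (x : V) (X : G.Walk x x), X.IsCycle ∧
      (∃ t1 ∈ S, ∃ t2 ∈ S, t1 ≠ t2 ∧ t1 ∈ X.support ∧ t2 ∈ X.support) ∧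
      wcost c X / (∑ t ∈ S.filter (· ∈ X.support), w t)
        ≤ (∑ e ∈ G.edgeFinset, c e) / (∑ t ∈ S, w t) := by
  obtain ⟨x, X, hX, hle⟩ := exists_isNontrivialCycle_density_le G hG c hc S hS w hw
  refine ⟨x, X, hX.isCycle, hX.exists_terminals, ?_⟩
  exact (div_le_div_iff₀ (hX.terminalWeight_pos hw)
    (sum_pos hw (card_pos.1 (by omega)))).2 hle
end

section
/- Let G be a graph that is minimally 2-vertex-connected on its terminals, i.e., all terminals are pairwise 2-connected in G, but for every edge e, some pair of terminals fails to be 2-connected in G − e. Then every cycle of G contains at least 2 terminals. -/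
open SimpleGraph

/-- Two vertices are 2-connected: there are two internally vertex-disjoint
(and edge-disjoint) paths between them. -/
def TwoConnPair {V : Type*} (G : SimpleGraph V) (a b : V) : Prop :=
  ∃ (p q : G.Walk a b), p.IsPath ∧ q.IsPath ∧
    (∀ x ∈ p.support, x ∈ q.support → x = a ∨ x = b) ∧
    (∀ e ∈ p.edges, e ∉ q.edges)

namespace SimpleGraph

variable {V : Type*}

/-- A walk from inside `Y` to outside `Y` traverses an edge leaving `Y`. -/
theorem Walk.exists_boundary_edge {G : SimpleGraph V} {u v : V} (p : G.Walk u v) (Y : Set V)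
    (hu : u ∈ Y) (hv : v ∉ Y) :
    ∃ a b, G.Adj a b ∧ a ∈ Y ∧ b ∉ Y ∧ s(a, b) ∈ p.edges ∧ a ∈ p.support ∧ b ∈ p.support := by
  obtain ⟨d, hd, h1, h2⟩ := p.exists_boundary_dart Y hu hv
  have he : s(d.fst, d.snd) ∈ p.edges := List.mem_map.2 ⟨d, hd, rfl⟩
  exact ⟨d.fst, d.snd, d.adj, h1, h2, he, p.fst_mem_support_of_mem_edges he,
    p.snd_mem_support_of_mem_edges he⟩

/-- `H.ReachAvoid A v` is the set of vertices joined to `A` by a walk of `H` avoiding `v`. -/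
def ReachAvoid (H : SimpleGraph V) (A : Set V) (v : V) : Set V :=
  {u | ∃ a ∈ A, ∃ p : H.Walk a u, v ∉ p.support}

theorem mem_reachAvoid_of_mem {H : SimpleGraph V} {A : Set V} {v a : V} (ha : a ∈ A)
    (hav : a ≠ v) : a ∈ H.ReachAvoid A v :=
  ⟨a, ha, Walk.nil, by simpa using hav.symm⟩

theorem ne_of_mem_reachAvoid {H : SimpleGraph V} {A : Set V} {v u : V}
    (h : u ∈ H.ReachAvoid A v) : u ≠ v := by
  obtain ⟨a, _, p, hp⟩ := h
  rintro rfl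
  exact hp p.end_mem_support

theorem mem_reachAvoid_of_adj {H : SimpleGraph V} {A : Set V} {v a b : V}
    (ha : a ∈ H.ReachAvoid A v) (hab : H.Adj a b) (hb : b ≠ v) : b ∈ H.ReachAvoid A v := by
  obtain ⟨c, hc, p, hp⟩ := ha
  exact ⟨c, hc, p.concat hab, by simp [Walk.support_concat, hp, hb.symm]⟩

theorem mem_reachAvoid_of_mem_support {H : SimpleGraph V} {A : Set V} {v a b z : V}
    (ha : a ∈ A) (p : H.Walk a b) (hp : v ∉ p.support) (hz : z ∈ p.support) :
    z ∈ H.ReachAvoid A v := by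
  classical
  exact ⟨a, ha, p.takeUntil z hz, fun h => hp (p.support_takeUntil_subset_support hz h)⟩

theorem exists_walk_support_subset_reachAvoid {H : SimpleGraph V} {A : Set V} {v a : V}
    (ha : a ∈ A) (p : H.Walk a v) :
    ∃ q : H.Walk a v, q.support ⊆ p.support ∧ ∀ z ∈ q.support, z = v ∨ z ∈ H.ReachAvoid A v := by
  classical
  refine ⟨p.bypass, p.support_bypass_subset_support, fun z hz => ?_⟩
  by_cases h : z = v
  · exact .inl h
  · exact .inr ⟨a, ha, p.bypass.takeUntil z hz,
      Walk.endpoint_notMem_support_takeUntil p.bypass_isPath hz (Ne.symm h)⟩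

/-- If `v` separates `A` from `B` in `H'` and `H` arises from `H'` by adding an edge `xy` whose end
`y` is not on the side of `A`, then a walk of `H` from `A` to `B` avoiding `u` yields a walk of `H'`
from `A` to `v` or `x` avoiding `u`. -/
theorem mem_reachAvoid_or_of_walk {H H' : SimpleGraph V} {A B : Set V} {v x y u a b : V}
    (hadj : ∀ a b, H.Adj a b → H'.Adj a b ∨ (a = x ∧ b = y) ∨ (a = y ∧ b = x))
    (hsep : ∀ a ∈ A, ∀ b ∈ B, ∀ p : H'.Walk a b, v ∈ p.support)
    (hy : y ∉ H'.ReachAvoid A v) (ha : a ∈ A) (hb : b ∈ B) (p : H.Walk a b)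
    (hp : u ∉ p.support) : v ∈ H'.ReachAvoid A u ∨ x ∈ H'.ReachAvoid A u := by
  by_contra! hcon
  obtain ⟨hv, hx⟩ := hcon
  have hau : a ∈ H'.ReachAvoid A u :=
    mem_reachAvoid_of_mem ha (by rintro rfl; exact hp p.start_mem_support)
  obtain ⟨c, d, hcd, hc, hd, -, -, hds⟩ :=
    p.exists_boundary_edge (H'.ReachAvoid A u ∩ H'.ReachAvoid A v)
      ⟨hau, mem_reachAvoid_of_mem ha (by rintro rfl; exact hv hau)⟩
      (by
        rintro ⟨-, a', ha', q, hq⟩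
        exact hq (hsep a' ha' b hb q))
  rcases hadj c d hcd with h | ⟨rfl, rfl⟩ | ⟨rfl, rfl⟩
  · have hdu : d ∈ H'.ReachAvoid A u :=
      mem_reachAvoid_of_adj hc.1 h (by rintro rfl; exact hp hds)
    exact hd ⟨hdu, mem_reachAvoid_of_adj hc.2 h (by rintro rfl; exact hv hdu)⟩
  · exact hx hc.1
  · exact hy hc.2

theorem exists_disjoint_walks_to_pair {H : SimpleGraph V} {A : Set V} {v x a b a' b' : V}
    (ha : a ∈ A) (hb : b ∈ ({v, x} : Set V)) (ha' : a' ∈ A) (hb' : b' ∈ ({v, x} : Set V))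
    (p : H.Walk a b) (q : H.Walk a' b') (h : ∀ z ∈ p.support, z ∉ q.support) :
    ∃ a ∈ A, ∃ a' ∈ A, ∃ p : H.Walk a v, ∃ q : H.Walk a' x,
      (∀ z ∈ p.support, z ∉ q.support) ∧
      (∀ z ∈ p.support, z = v ∨ z ∈ H.ReachAvoid A v) ∧
      (∀ z ∈ q.support, z ∈ H.ReachAvoid A v) := by
  have key : ∀ a ∈ A, ∀ a' ∈ A, ∀ (p : H.Walk a v) (q : H.Walk a' x),
      (∀ z ∈ p.support, z ∉ q.support) → ∃ a ∈ A, ∃ a' ∈ A, ∃ p : H.Walk a v, ∃ q : H.Walk a' x,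
      (∀ z ∈ p.support, z ∉ q.support) ∧
      (∀ z ∈ p.support, z = v ∨ z ∈ H.ReachAvoid A v) ∧
      (∀ z ∈ q.support, z ∈ H.ReachAvoid A v) := by
    intro a ha a' ha' p q h
    obtain ⟨p', hp', hp'A⟩ := exists_walk_support_subset_reachAvoid ha p
    exact ⟨a, ha, a', ha', p', q, fun z hz => h z (hp' hz), hp'A, fun z hz =>
      mem_reachAvoid_of_mem_support ha' q (h v p.end_mem_support) hz⟩
  rcases hb with rfl | rfl <;> rcases hb' with rfl | rfl
  · exact absurd q.end_mem_support (h _ p.end_mem_support)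
  · exact key a ha a' ha' p q h
  · exact key a' ha' a ha q p fun z hz hz' => h z hz' hz
  · exact absurd q.end_mem_support (h _ p.end_mem_support)

/-- **Menger's theorem** for two disjoint paths between two vertex sets. -/
theorem exists_disjoint_walks_of_forall_avoid [Nonempty V] (H : SimpleGraph V)
    (hfin : H.edgeSet.Finite) (A B : Set V)
    (h : ∀ v, ∃ a ∈ A, ∃ b ∈ B, ∃ p : H.Walk a b, v ∉ p.support) :
    ∃ a ∈ A, ∃ b ∈ B, ∃ a' ∈ A, ∃ b' ∈ B, ∃ p : H.Walk a b, ∃ q : H.Walk a' b',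
      ∀ z ∈ p.support, z ∉ q.support := by
  induction hn : H.edgeSet.ncard using Nat.strong_induction_on generalizing H A B with
  | _ n ih =>
  subst hn
  by_cases hE : ∃ x y, H.Adj x y
  swap
  · push Not at hE
    obtain ⟨w⟩ := ‹Nonempty V›
    have key : ∀ v, ∃ a ∈ A, a ∈ B ∧ a ≠ v := by
      intro v
      obtain ⟨a, ha, b, hb, p, hp⟩ := h v
      cases p with
      | nil => exact ⟨a, ha, hb, by simpa [eq_comm] using hp⟩
      | cons e _ => exact absurd e (hE _ _)
    obtain ⟨a, ha, hab, -⟩ := key w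
    obtain ⟨c, hc, hcb, hca⟩ := key a
    exact ⟨a, ha, a, hab, c, hc, c, hcb, Walk.nil, Walk.nil, by simpa using hca.symm⟩
  obtain ⟨x₀, y₀, hxy₀⟩ := hE
  set H' := H.deleteEdges {s(x₀, y₀)} with hH'
  have hle : H' ≤ H := deleteEdges_le _
  have hlt : H'.edgeSet.ncard < H.edgeSet.ncard := by
    rw [hH', edgeSet_deleteEdges]
    exact Set.ncard_sdiff_singleton_lt_of_mem hxy₀ hfin
  have hfin' : H'.edgeSet.Finite := hfin.subset (edgeSet_mono hle)
  by_cases h' : ∀ v, ∃ a ∈ A, ∃ b ∈ B, ∃ p : H'.Walk a b, v ∉ p.support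
  · obtain ⟨a, ha, b, hb, a', ha', b', hb', p, q, hpq⟩ := ih _ hlt H' hfin' A B h' rfl
    exact ⟨a, ha, b, hb, a', ha', b', hb', p.mapLe hle, q.mapLe hle, by simpa using hpq⟩
  push Not at h'
  obtain ⟨v, hv⟩ := h'
  have hdisj : ∀ z, z ∈ H'.ReachAvoid A v → z ∉ H'.ReachAvoid B v := by
    rintro z ⟨a, ha, p, hp⟩ ⟨b, hb, q, hq⟩
    have := hv a ha b hb (p.append q.reverse)
    simp [Walk.mem_support_append_iff, hp, hq] at this
  obtain ⟨x, y, hxy, hx, hy, hadj⟩ : ∃ x y, H.Adj x y ∧ x ∈ H'.ReachAvoid A v ∧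
      y ∈ H'.ReachAvoid B v ∧
      ∀ a b, H.Adj a b → H'.Adj a b ∨ (a = x ∧ b = y) ∨ (a = y ∧ b = x) := by
    have hadj₀ : ∀ a b, H.Adj a b → H'.Adj a b ∨ (a = x₀ ∧ b = y₀) ∨ (a = y₀ ∧ b = x₀) := by
      intro a b hab
      simp only [hH', deleteEdges_adj, Set.mem_singleton_iff, Sym2.eq_iff]
      tauto
    obtain ⟨a, ha, b, hb, p, hp⟩ := h v
    have hav : a ≠ v := by rintro rfl; exact hp p.start_mem_support
    have hbv : b ≠ v := by rintro rfl; exact hp p.end_mem_support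
    have hb' : b ∈ H'.ReachAvoid B v := mem_reachAvoid_of_mem hb hbv
    have ha' : a ∈ H'.ReachAvoid A v := mem_reachAvoid_of_mem ha hav
    obtain ⟨c, d, hcd, hc, hd, -, -, hds⟩ := p.exists_boundary_edge _ ha'
      (fun h => hdisj b h hb')
    obtain ⟨c', d', hcd', hc', hd', -, -, hds'⟩ := p.reverse.exists_boundary_edge _ hb' (hdisj a ha')
    have hdv : d ≠ v := by rintro rfl; exact hp hds
    have hdv' : d' ≠ v := by rintro rfl; exact hp (by simpa using hds')
    have h1 : (c = x₀ ∧ d = y₀) ∨ (c = y₀ ∧ d = x₀) :=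
      (hadj₀ c d hcd).resolve_left fun h => hd (mem_reachAvoid_of_adj hc h hdv)
    have h2 : (c' = x₀ ∧ d' = y₀) ∨ (c' = y₀ ∧ d' = x₀) :=
      (hadj₀ c' d' hcd').resolve_left fun h => hd' (mem_reachAvoid_of_adj hc' h hdv')
    have hne : c ≠ c' := by rintro rfl; exact hdisj c hc hc'
    have hd : d = c' := by grind
    subst hd
    refine ⟨c, d, hcd, hc, hc', fun a b hab => ?_⟩
    have := hadj₀ a b hab
    grind
  have hadj' : ∀ a b, H.Adj a b → H'.Adj a b ∨ (a = y ∧ b = x) ∨ (a = x ∧ b = y) :=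
    fun a b hab => by have := hadj a b hab; tauto
  have hA : ∀ u, ∃ a ∈ A, ∃ b ∈ ({v, x} : Set V), ∃ p : H'.Walk a b, u ∉ p.support := by
    intro u
    obtain ⟨a, ha, b, hb, p, hp⟩ := h u
    rcases mem_reachAvoid_or_of_walk hadj hv (fun h => hdisj y h hy) ha hb p hp with
      ⟨a, ha, q, hq⟩ | ⟨a, ha, q, hq⟩
    · exact ⟨a, ha, v, by simp, q, hq⟩
    · exact ⟨a, ha, x, by simp, q, hq⟩
  have hB : ∀ u, ∃ a ∈ B, ∃ b ∈ ({v, y} : Set V), ∃ p : H'.Walk a b, u ∉ p.support := by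
    intro u
    obtain ⟨a, ha, b, hb, p, hp⟩ := h u
    rcases mem_reachAvoid_or_of_walk hadj'
      (fun b hb a ha q => by simpa using hv a ha b hb q.reverse) (hdisj x hx) hb ha p.reverse
      (by simpa using hp) with ⟨a, ha, q, hq⟩ | ⟨a, ha, q, hq⟩
    · exact ⟨a, ha, v, by simp, q, hq⟩
    · exact ⟨a, ha, y, by simp, q, hq⟩
  obtain ⟨a, ha, b, hb, a', ha', b', hb', p, q, hpq⟩ := ih _ hlt H' hfin' A _ hA rfl
  obtain ⟨a, ha, a', ha', p, q, hpq, hp, hq⟩ :=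
    exists_disjoint_walks_to_pair ha hb ha' hb' p q hpq
  obtain ⟨c, hc, d, hd, c', hc', d', hd', r, t, hrt⟩ := ih _ hlt H' hfin' B _ hB rfl
  obtain ⟨c, hc, c', hc', r, t, hrt, hr, ht⟩ :=
    exists_disjoint_walks_to_pair hc hd hc' hd' r t hrt
  refine ⟨a, ha, c, hc, a', ha', c', hc', (p.mapLe hle).append (r.mapLe hle).reverse,
    (q.mapLe hle).append (Walk.cons hxy (t.mapLe hle).reverse), fun z hz hz' => ?_⟩
  have hz1 : z ∈ p.support ∨ z ∈ r.support := by
    simpa [Walk.mem_support_append_iff] using hz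
  have hz2 : z ∈ q.support ∨ z ∈ t.support := by
    have : z ∈ q.support ∨ z = x ∨ z ∈ t.support := by
      simpa [Walk.mem_support_append_iff] using hz'
    rcases this with h | rfl | h
    · exact .inl h
    · exact .inl q.end_mem_support
    · exact .inr h
  rcases hz1 with h1 | h1 <;> rcases hz2 with h2 | h2
  · exact hpq z h1 h2
  · rcases hp z h1 with rfl | h
    · exact ne_of_mem_reachAvoid (ht z h2) rfl
    · exact hdisj z h (ht z h2)
  · rcases hr z h1 with rfl | h
    · exact ne_of_mem_reachAvoid (hq z h2) rfl
    · exact hdisj z (hq z h2) h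
  · exact hrt z h1 h2

theorem exists_neighbor_walk_of_walk {H : SimpleGraph V} {s t : V} (hst : s ≠ t)
    (hadj : ¬ H.Adj s t) (p : H.Walk s t) :
    ∃ a ∈ H.neighborSet s, ∃ b ∈ H.neighborSet t, ∃ q : H.Walk a b,
      q.support ⊆ p.support ∧ s ∉ q.support ∧ t ∉ q.support := by
  classical
  suffices ∀ p : H.Walk s t, p.IsPath → ∃ a ∈ H.neighborSet s, ∃ b ∈ H.neighborSet t,
      ∃ q : H.Walk a b, q.support ⊆ p.support ∧ s ∉ q.support ∧ t ∉ q.support by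
    obtain ⟨a, ha, b, hb, q, hq, h⟩ := this p.bypass p.bypass_isPath
    exact ⟨a, ha, b, hb, q, fun z hz => p.support_bypass_subset_support (hq hz), h⟩
  intro p hp
  cases p with
  | nil => exact absurd rfl hst
  | cons hs p =>
    rename_i a
    rw [Walk.cons_isPath_iff] at hp
    obtain ⟨r, hr⟩ : ∃ r, r = p.reverse := ⟨_, rfl⟩
    have hrp : r.IsPath := hr ▸ hp.1.reverse
    have hsupp : ∀ z, z ∈ r.support → z ∈ p.support := fun z hz => by simpa [hr] using hz
    cases r with
    | nil => exact absurd hs hadj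
    | cons ht r =>
      rw [Walk.cons_isPath_iff] at hrp
      have hsupp' : ∀ z, z ∈ r.support → z ∈ p.support := fun z hz =>
        hsupp z (by rw [Walk.support_cons]; exact List.mem_cons_of_mem _ hz)
      refine ⟨a, hs, _, ht, r.reverse, fun z hz => ?_, fun hz => ?_, by simpa using hrp.2⟩
      · exact List.mem_cons_of_mem _ (hsupp' z (by simpa using hz))
      · exact hp.2 (hsupp' s (by simpa using hz))

/-- Two vertices that are connected but not 2-connected are separated by an edge joining them or
by a third vertex. -/
theorem exists_separator_of_not_twoConnPair {H : SimpleGraph V} (hfin : H.edgeSet.Finite)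
    {s t : V} (hst : s ≠ t) (hreach : H.Reachable s t) (h : ¬ TwoConnPair H s t) :
    (H.Adj s t ∧ ¬ (H.deleteEdges {s(s, t)}).Reachable s t) ∨
      ∃ v, v ≠ s ∧ v ≠ t ∧ ∀ p : H.Walk s t, v ∈ p.support := by
  classical
  contrapose! h
  obtain ⟨h1, h2⟩ := h
  by_cases hadj : H.Adj s t
  · obtain ⟨p, hp⟩ := (h1 hadj).exists_isPath
    have hle : H.deleteEdges {s(s, t)} ≤ H := deleteEdges_le _
    refine ⟨hadj.toWalk, p.mapLe hle, by simp [hst], hp.mapLe hle, by simp, ?_⟩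
    intro e he he'
    have he₂ : e ∈ p.edges := by simpa using he'
    have := p.edges_subset_edgeSet he₂
    simp_all
  · have : Nonempty V := ⟨s⟩
    obtain ⟨a, ha, b, hb, a', ha', b', hb', p, q, hpq⟩ :=
      exists_disjoint_walks_of_forall_avoid H hfin (H.neighborSet s) (H.neighborSet t) (by
        intro v
        by_cases hv : v = s ∨ v = t
        · obtain ⟨r⟩ := hreach
          obtain ⟨a, ha, b, hb, q, -, hs, ht⟩ := exists_neighbor_walk_of_walk hst hadj r
          exact ⟨a, ha, b, hb, q, by rcases hv with rfl | rfl <;> assumption⟩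
        · push Not at hv
          obtain ⟨r, hr⟩ := h2 v hv.1 hv.2
          obtain ⟨a, ha, b, hb, q, hq, -, -⟩ := exists_neighbor_walk_of_walk hst hadj r
          exact ⟨a, ha, b, hb, q, fun h => hr (hq h)⟩)
    have key : ∀ a b, H.Adj s a → H.Adj t b → ∀ p : H.Walk a b,
        ∃ r : H.Walk s t, r.IsPath ∧ ∀ z ∈ r.support, z ∈ p.support ∨ z = s ∨ z = t := by
      intro a b ha hb p
      refine ⟨((p.cons ha).concat hb.symm).bypass, Walk.bypass_isPath _, fun z hz => ?_⟩
      have := Walk.support_bypass_subset_support _ hz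
      rw [Walk.support_concat, Walk.support_cons] at this
      simp only [List.mem_append, List.mem_cons, List.not_mem_nil] at this
      tauto
    obtain ⟨p', hp', hps⟩ := key a b ha hb p
    obtain ⟨q', hq', hqs⟩ := key a' b' ha' hb' q
    have hv : ∀ z ∈ p'.support, z ∈ q'.support → z = s ∨ z = t := by
      intro z h1 h2
      have := hps z h1
      have := hqs z h2
      have := hpq z
      tauto
    refine ⟨p', q', hp', hq', hv, fun e he he' => ?_⟩
    induction e with
    | _ c d =>
    have hcd : H.Adj c d := p'.adj_of_mem_edges he
    have hc := hv c (p'.fst_mem_support_of_mem_edges he) (q'.fst_mem_support_of_mem_edges he')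
    have hd := hv d (p'.snd_mem_support_of_mem_edges he) (q'.snd_mem_support_of_mem_edges he')
    rcases hc with rfl | rfl <;> rcases hd with rfl | rfl
    · exact hcd.ne rfl
    · exact hadj hcd
    · exact hadj hcd.symm
    · exact hcd.ne rfl

/-- A cycle that traverses an edge leaving `Y` traverses a second one. -/
theorem Walk.IsCycle.exists_ne_boundary_edge {G : SimpleGraph V} {u x y : V} {c : G.Walk u u}
    (hc : c.IsCycle) {Y : Set V} (hx : x ∈ Y) (hy : y ∉ Y) (he : s(x, y) ∈ c.edges) :
    ∃ a b, a ∈ Y ∧ b ∉ Y ∧ s(a, b) ∈ c.edges ∧ s(a, b) ≠ s(x, y) := by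
  have hsub : ∀ e ∈ c.edges, e ∈ (fromEdgeSet {e | e ∈ c.edges}).edgeSet := by
    intro e he
    rw [edgeSet_fromEdgeSet]
    exact ⟨he, G.not_isDiag_of_mem_edgeSet (c.edges_subset_edgeSet he)⟩
  obtain ⟨-, ⟨p⟩⟩ := adj_and_reachable_delete_edges_iff_exists_cycle.2
    ⟨u, c.transfer _ hsub, hc.transfer hsub, by simpa using he⟩
  obtain ⟨a, b, hab, ha, hb, -⟩ := p.exists_boundary_edge Y hx hy
  rw [deleteEdges_adj, fromEdgeSet_adj] at hab
  exact ⟨a, b, ha, hb, hab.1.1, hab.2⟩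

/-- The edge `xy` and the vertex `v` together separate the side `A`, which contains `x`, from the
remaining vertices, and both sides contain elements of `S`. -/
structure EdgeVertexCut (G : SimpleGraph V) (S : Set V) (x y v : V) (A : Set V) : Prop where
  fst_mem : x ∈ A
  snd_notMem : y ∉ A
  vertex_notMem : v ∉ A
  snd_ne : y ≠ v
  boundary : ∀ a b, a ∈ A → b ∉ A → G.Adj a b → b = v ∨ (a = x ∧ b = y)
  exists_mem : ∃ s ∈ S, s ∈ A
  exists_notMem : ∃ t ∈ S, t ∉ A ∧ t ≠ v

theorem EdgeVertexCut.swap {G : SimpleGraph V} {S : Set V} {x y v : V} {A : Set V}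
    (h : G.EdgeVertexCut S x y v A) : G.EdgeVertexCut S y x v {z | z ∉ A ∧ z ≠ v} where
  fst_mem := ⟨h.snd_notMem, h.snd_ne⟩
  snd_notMem := fun h' => h'.1 h.fst_mem
  vertex_notMem := fun h' => h'.2 rfl
  snd_ne := fun h' => h.vertex_notMem (h' ▸ h.fst_mem)
  boundary := by
    rintro a b ⟨ha, hav⟩ hb hab
    by_cases hbv : b = v
    · exact .inl hbv
    · have hbA : b ∈ A := by
        by_contra hbA
        exact hb ⟨hbA, hbv⟩
      have := h.boundary b a hbA ha hab.symm
      tauto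
  exists_mem := by
    obtain ⟨t, ht, h1⟩ := h.exists_notMem
    exact ⟨t, ht, h1⟩
  exists_notMem := by
    obtain ⟨s, hs, hsA⟩ := h.exists_mem
    exact ⟨s, hs, fun h' => h'.1 hsA, by rintro rfl; exact h.vertex_notMem hsA⟩

theorem not_separates_of_twoConnPair {G : SimpleGraph V} {S : Set V}
    (h2 : ∀ s ∈ S, ∀ t ∈ S, s ≠ t → TwoConnPair G s t) {Y : Set V} {w : V}
    (hY : ∀ a b, a ∈ Y → b ∉ Y → G.Adj a b → b = w) (hin : ∃ s ∈ S, s ∈ Y)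
    (hout : ∃ t ∈ S, t ∉ Y ∧ t ≠ w) : False := by
  obtain ⟨s, hs, hsY⟩ := hin
  obtain ⟨t, ht, htY, htw⟩ := hout
  obtain ⟨p, q, -, -, hv, -⟩ := h2 s hs t ht (by rintro rfl; exact htY hsY)
  obtain ⟨a, b, hab, ha, hb, -, -, hbp⟩ := p.exists_boundary_edge Y hsY htY
  obtain ⟨c, d, hcd, hc, hd, -, -, hdq⟩ := q.exists_boundary_edge Y hsY htY
  obtain rfl := hY a b ha hb hab
  obtain rfl := hY c d hc hd hcd
  rcases hv _ hbp hdq with rfl | rfl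
  · exact hb hsY
  · exact htw rfl

theorem edgeSet_finite_of_minimal {G : SimpleGraph V} {S : Set V} (hS : S.Finite)
    (h2 : ∀ s ∈ S, ∀ t ∈ S, s ≠ t → TwoConnPair G s t)
    (hmin : ∀ e ∈ G.edgeSet,
      ∃ s ∈ S, ∃ t ∈ S, s ≠ t ∧ ¬ TwoConnPair (G.deleteEdges {e}) s t) :
    G.edgeSet.Finite := by
  classical
  have key : ∀ s t, ∃ F : Set (Sym2 V), F.Finite ∧ (s ∈ S → t ∈ S → s ≠ t →
      ∀ e, e ∉ F → TwoConnPair (G.deleteEdges {e}) s t) := by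
    intro s t
    by_cases h : s ∈ S ∧ t ∈ S ∧ s ≠ t
    · obtain ⟨p, q, hp, hq, hv, he⟩ := h2 s h.1 t h.2.1 h.2.2
      refine ⟨{e | e ∈ p.edges} ∪ {e | e ∈ q.edges},
        (List.finite_toSet p.edges).union (List.finite_toSet q.edges), fun _ _ _ e heF => ?_⟩
      exact ⟨p.toDeleteEdge e fun h => heF (.inl h), q.toDeleteEdge e fun h => heF (.inr h),
        hp.transfer _, hq.transfer _, by simpa using hv, by simpa using he⟩
    · exact ⟨∅, Set.finite_empty, fun hs ht hst => absurd ⟨hs, ht, hst⟩ h⟩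
  choose F hF hdel using key
  refine (hS.biUnion fun s _ => hS.biUnion fun t _ => hF s t).subset fun e he => ?_
  obtain ⟨s, hs, t, ht, hst, hnot⟩ := hmin e he
  simp only [Set.mem_iUnion]
  refine ⟨s, hs, t, ht, ?_⟩
  by_contra heF
  exact hnot (hdel s t hs ht hst e heF)

theorem exists_edgeVertexCut {G : SimpleGraph V} {S : Set V} (hfin : G.edgeSet.Finite)
    (h2 : ∀ s ∈ S, ∀ t ∈ S, s ≠ t → TwoConnPair G s t)
    (hmin : ∀ e ∈ G.edgeSet,
      ∃ s ∈ S, ∃ t ∈ S, s ≠ t ∧ ¬ TwoConnPair (G.deleteEdges {e}) s t)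
    {u x y : V} {c : G.Walk u u} (hc : c.IsCycle)
    (hcS : ∀ s ∈ S, ∀ t ∈ S, s ∈ c.support → t ∈ c.support → s = t)
    (he : s(x, y) ∈ c.edges) : ∃ v A, G.EdgeVertexCut S x y v A := by
  have hxy : G.Adj x y := c.adj_of_mem_edges he
  obtain ⟨s, hs, t, ht, hst, hnot⟩ := hmin s(x, y) hxy
  obtain ⟨p, q, -, -, hvert, hedge⟩ := h2 s hs t ht hst
  set H := G.deleteEdges {s(x, y)} with hH
  have hHadj : ∀ a b, G.Adj a b → H.Adj a b ∨ s(a, b) = s(x, y) := by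
    intro a b hab
    simp only [hH, deleteEdges_adj, Set.mem_singleton_iff]
    tauto
  have hreach : H.Reachable s t := by
    by_cases hp : s(x, y) ∈ p.edges
    · exact ⟨q.toDeleteEdge _ (hedge _ hp)⟩
    · exact ⟨p.toDeleteEdge _ hp⟩
  rcases exists_separator_of_not_twoConnPair
    (hfin.subset (edgeSet_mono (deleteEdges_le _))) hst hreach hnot with ⟨-, hbr⟩ | ⟨v, hvs, hvt, hv⟩
  · exfalso
    set Y : Set V := {z | (H.deleteEdges {s(s, t)}).Reachable s z} with hY
    have hsY : s ∈ Y := Reachable.refl _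
    have hbd : ∀ a b, a ∈ Y → b ∉ Y → G.Adj a b → s(a, b) = s(x, y) ∨ s(a, b) = s(s, t) := by
      intro a b ha hb hab
      by_contra! hcon
      refine hb (Reachable.trans ha (Adj.reachable ?_))
      rw [deleteEdges_adj]
      exact ⟨(hHadj a b hab).resolve_right hcon.1, hcon.2⟩
    have hxyY : (x ∈ Y ∧ y ∉ Y) ∨ (y ∈ Y ∧ x ∉ Y) := by
      obtain ⟨a, b, hab, ha, hb, hep, -⟩ := p.exists_boundary_edge Y hsY hbr
      obtain ⟨a', b', hab', ha', hb', heq, -⟩ := q.exists_boundary_edge Y hsY hbr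
      have h1 := hbd a b ha hb hab
      have h1' := hbd a' b' ha' hb' hab'
      have hne : s(a, b) ≠ s(a', b') := fun h => hedge _ hep (h ▸ heq)
      have hor : s(a, b) = s(x, y) ∨ s(a', b') = s(x, y) := by
        rcases h1 with h1 | h1
        · exact .inl h1
        · exact .inr (h1'.resolve_right fun h => hne (h1.trans h.symm))
      rcases hor with h | h <;> rcases Sym2.eq_iff.1 h with ⟨rfl, rfl⟩ | ⟨rfl, rfl⟩ <;> tauto
    have hstc : s(s, t) ∈ c.edges := by
      rcases hxyY with ⟨hx, hy⟩ | ⟨hy, hx⟩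
      · obtain ⟨a, b, ha, hb, hab, hne⟩ := hc.exists_ne_boundary_edge hx hy he
        exact (hbd a b ha hb (c.adj_of_mem_edges hab)).resolve_left hne ▸ hab
      · obtain ⟨a, b, ha, hb, hab, hne⟩ :=
          hc.exists_ne_boundary_edge hy hx (by rwa [Sym2.eq_swap])
        rw [Sym2.eq_swap (a := y)] at hne
        exact (hbd a b ha hb (c.adj_of_mem_edges hab)).resolve_left hne ▸ hab
    exact hst (hcS s hs t ht (c.fst_mem_support_of_mem_edges hstc)
      (c.snd_mem_support_of_mem_edges hstc))
  · set Y := H.ReachAvoid {s} v with hY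
    have hsY : s ∈ Y := mem_reachAvoid_of_mem rfl hvs.symm
    have hvY : v ∉ Y := fun h => ne_of_mem_reachAvoid h rfl
    have htY : t ∉ Y := by
      rintro ⟨_, rfl, r, hr⟩
      exact hr (hv r)
    have hbd : ∀ a b, a ∈ Y → b ∉ Y → G.Adj a b → b = v ∨ s(a, b) = s(x, y) := by
      intro a b ha hb hab
      by_contra! hcon
      exact hb (mem_reachAvoid_of_adj ha ((hHadj a b hab).resolve_right hcon.2) hcon.1)
    obtain ⟨a, b, hab, ha, hb, hbv, heq⟩ :
        ∃ a b, G.Adj a b ∧ a ∈ Y ∧ b ∉ Y ∧ b ≠ v ∧ s(a, b) = s(x, y) := by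
      by_contra! hcon
      refine not_separates_of_twoConnPair h2 (Y := Y) (w := v) (fun a b ha hb hab => ?_)
        ⟨s, hs, hsY⟩ ⟨t, ht, htY, hvt.symm⟩
      by_contra hbv
      exact hcon a b hab ha hb hbv ((hbd a b ha hb hab).resolve_left hbv)
    have hcut : G.EdgeVertexCut S a b v Y :=
      ⟨ha, hb, hvY, hbv, fun a' b' ha' hb' hab' => by
        refine (hbd a' b' ha' hb' hab').imp_right fun h => ?_
        rcases Sym2.eq_iff.1 (h.trans heq.symm) with h | ⟨rfl, rfl⟩
        · exact h
        · exact absurd ha hb', ⟨s, hs, hsY⟩, ⟨t, ht, htY, hvt.symm⟩⟩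
    rcases Sym2.eq_iff.1 heq with ⟨rfl, rfl⟩ | ⟨rfl, rfl⟩
    · exact ⟨v, _, hcut⟩
    · exact ⟨v, _, hcut.swap⟩

/-- Uncrossing: the side `A` of a cut can be shrunk as long as it contains no terminal of the cycle.
If `X` is the side of a cut at the other cycle edge at `x`, then `A ∩ X` is the side of a cut formed
by that edge and either the old or the new vertex. -/
theorem EdgeVertexCut.exists_smaller {G : SimpleGraph V} {S : Set V}
    (h2 : ∀ s ∈ S, ∀ t ∈ S, s ≠ t → TwoConnPair G s t)
    {u : V} {c : G.Walk u u} (hc : c.IsCycle)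
    (hcut : ∀ x y, s(x, y) ∈ c.edges → ∃ v A, G.EdgeVertexCut S x y v A)
    {x y v : V} {A : Set V} (he : s(x, y) ∈ c.edges) (h : G.EdgeVertexCut S x y v A)
    (hA : ∀ s ∈ S, s ∈ c.support → s ∉ A) :
    ∃ x' y' v' A', s(x', y') ∈ c.edges ∧ G.EdgeVertexCut S x' y' v' A' ∧ A' ⊆ A ∧ x ∉ A' := by
  have hxc : x ∈ c.support := c.fst_mem_support_of_mem_edges he
  have hxS : x ∉ S := fun hx => hA x hx hxc h.fst_mem
  have hxy : G.Adj x y := c.adj_of_mem_edges he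
  obtain ⟨x₁, x', hx₁, -, hf, hne⟩ :=
    hc.exists_ne_boundary_edge (Y := {x}) rfl (by simpa using hxy.ne') he
  rw [Set.mem_singleton_iff.1 hx₁] at hf hne
  have hx'y : x' ≠ y := by rintro rfl; exact hne rfl
  have hxx' : G.Adj x x' := c.adj_of_mem_edges hf
  have hf' : s(x', x) ∈ c.edges := by rwa [Sym2.eq_swap]
  obtain ⟨w, X, hX⟩ := hcut x' x hf'
  have hxA := h.fst_mem
  have hyA := h.snd_notMem
  have hvA := h.vertex_notMem
  have hyv := h.snd_ne
  have hbA := h.boundary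
  have hx'X := hX.fst_mem
  have hxX := hX.snd_notMem
  have hwX := hX.vertex_notMem
  have hxw := hX.snd_ne
  have hbX := hX.boundary
  obtain ⟨s₀, hs₀, hs₀A⟩ := h.exists_mem
  obtain ⟨t₀, ht₀, ht₀A, ht₀v⟩ := h.exists_notMem
  obtain ⟨s₁, hs₁, hs₁X⟩ := hX.exists_mem
  obtain ⟨t₁, ht₁, ht₁X, ht₁w⟩ := hX.exists_notMem
  by_cases hvX : v ∈ X
  · have hwA : w ∉ A := by
      intro hwA
      have hyX : y ∉ X := fun hyX => by
        rcases hbX y x hyX hxX hxy.symm with h | ⟨h, -⟩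
        · exact hxw h
        · exact hx'y h.symm
      obtain ⟨a, b, ⟨haA, haX, haw⟩, hb, hab, hne'⟩ :=
        hc.exists_ne_boundary_edge (Y := {z | z ∉ A ∧ z ∉ X ∧ z ≠ w}) (x := y) (y := x)
          ⟨hyA, hyX, by rintro rfl; exact hyA hwA⟩ (fun h => h.1 hxA) (by rwa [Sym2.eq_swap])
      have hab' := c.adj_of_mem_edges hab
      by_cases hbA' : b ∈ A
      · rcases hbA b a hbA' haA hab'.symm with rfl | ⟨rfl, rfl⟩
        · exact haX hvX
        · exact hne' rfl
      · have hbX' : b ∈ X := by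
          by_contra hbX'
          exact hb ⟨hbA', hbX', by rintro rfl; exact hbA' hwA⟩
        rcases hbX b a hbX' haX hab'.symm with rfl | ⟨rfl, rfl⟩
        · exact haw rfl
        · exact haA hxA
    have hwv : w ≠ v := by rintro rfl; exact hwX hvX
    have hAX : ∃ s ∈ S, s ∈ A ∧ s ∈ X := by
      by_contra! hcon
      refine not_separates_of_twoConnPair h2 (Y := {z | z ∈ A ∧ z ∉ X ∧ z ≠ x}) (w := x) ?_
        ⟨s₀, hs₀, hs₀A, hcon s₀ hs₀ hs₀A, by rintro rfl; exact hxS hs₀⟩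
        ⟨t₀, ht₀, fun h => ht₀A h.1, by rintro rfl; exact hxS ht₀⟩
      rintro a b ⟨haA, haX, hax⟩ hb hab
      by_contra hbx
      by_cases hbA' : b ∈ A
      · have hbX' : b ∈ X := by
          by_contra hbX'
          exact hb ⟨hbA', hbX', hbx⟩
        rcases hbX b a hbX' haX hab.symm with rfl | ⟨rfl, rfl⟩
        · exact hwA haA
        · exact hax rfl
      · rcases hbA a b haA hbA' hab with rfl | ⟨rfl, rfl⟩
        · rcases hbX b a hvX haX hab.symm with rfl | ⟨rfl, rfl⟩
          · exact hwA haA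
          · exact hax rfl
        · exact hax rfl
    have hbd : ∀ a b, a ∈ A ∩ X → b ∉ A ∩ X → G.Adj a b → b = v ∨ (a = x' ∧ b = x) := by
      rintro a b ⟨haA, haX⟩ hb hab
      by_cases hbA' : b ∈ A
      · rcases hbX a b haX (fun h => hb ⟨hbA', h⟩) hab with rfl | h
        · exact absurd hbA' hwA
        · exact .inr h
      · rcases hbA a b haA hbA' hab with h | ⟨rfl, rfl⟩
        · exact .inl h
        · exact absurd haX hxX
    by_cases hx'A : x' ∈ A
    · exact ⟨x', x, v, A ∩ X, hf', ⟨⟨hx'A, hx'X⟩, fun h => hxX h.2, fun h => hvA h.1,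
        by rintro rfl; exact hvA hxA, hbd, hAX, ⟨t₀, ht₀, fun h => ht₀A h.1, ht₀v⟩⟩,
        Set.inter_subset_left, fun h => hxX h.2⟩
    · refine (not_separates_of_twoConnPair h2 (Y := A ∩ X) (w := v) (fun a b ha hb hab => ?_)
        hAX ⟨t₀, ht₀, fun h => ht₀A h.1, ht₀v⟩).elim
      rcases hbd a b ha hb hab with h | ⟨rfl, -⟩
      · exact h
      · exact absurd ha.1 hx'A
  · have hx'A : x' ∈ A := by
      by_contra hx'A
      rcases hbA x x' hxA hx'A hxx' with rfl | ⟨-, rfl⟩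
      · exact hvX hx'X
      · exact hx'y rfl
    have hyX : y ∉ X := fun hyX => by
      rcases hbX y x hyX hxX hxy.symm with h | ⟨h, -⟩
      · exact hxw h
      · exact hx'y h.symm
    refine ⟨x', x, w, A ∩ X, hf', ⟨⟨hx'A, hx'X⟩, fun h => hxX h.2, fun h => hwX h.2, hxw, ?_, ?_,
      ⟨t₁, ht₁, fun h => ht₁X h.2, ht₁w⟩⟩, Set.inter_subset_left, fun h => hxX h.2⟩
    · rintro a b ⟨haA, haX⟩ hb hab
      by_cases hbX' : b ∈ X
      · rcases hbA a b haA (fun h => hb ⟨h, hbX'⟩) hab with rfl | ⟨rfl, rfl⟩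
        · exact absurd hbX' hvX
        · exact absurd haX hxX
      · exact hbX a b haX hbX' hab
    · by_contra! hcon
      refine not_separates_of_twoConnPair h2 (Y := X \ A) (w := w) ?_
        ⟨s₁, hs₁, hs₁X, fun h => hcon s₁ hs₁ ⟨h, hs₁X⟩⟩ ⟨t₁, ht₁, fun h => ht₁X h.1, ht₁w⟩
      rintro a b ⟨haX, haA⟩ hb hab
      by_cases hbA' : b ∈ A
      · rcases hbA b a hbA' haA hab.symm with rfl | ⟨rfl, rfl⟩
        · exact absurd haX hvX
        · exact absurd haX hyX
      · rcases hbX a b haX (fun h => hb ⟨h, hbA'⟩) hab with h | ⟨-, rfl⟩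
        · exact h
        · exact absurd hxA hbA'

end SimpleGraph

theorem minimally_two_connected_on_terminals_cycles_nontrivial
    {V : Type*} (G : SimpleGraph V) (S : Set V) (hS : 2 ≤ S.ncard)
    -- every pair of terminals is 2-connected in G
    (h2 : ∀ s ∈ S, ∀ t ∈ S, s ≠ t → TwoConnPair G s t)
    -- deleting any edge destroys 2-connectivity for some pair of terminals
    (hmin : ∀ e ∈ G.edgeSet,
      ∃ s ∈ S, ∃ t ∈ S, s ≠ t ∧ ¬ TwoConnPair (G.deleteEdges {e}) s t) :
    ∀ (x : V) (Cyc : G.Walk x x), Cyc.IsCycle →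
      ∃ t1 ∈ S, ∃ t2 ∈ S, t1 ≠ t2 ∧ t1 ∈ Cyc.support ∧ t2 ∈ Cyc.support := by
  intro u c hc
  by_contra! hcon
  have hcS : ∀ s ∈ S, ∀ t ∈ S, s ∈ c.support → t ∈ c.support → s = t := by
    intro s hs t ht hsc htc
    by_contra hne
    exact hcon s hs t ht hne hsc htc
  have hfin := edgeSet_finite_of_minimal (Set.finite_of_ncard_pos (by omega)) h2 hmin
  have hcut : ∀ x y, s(x, y) ∈ c.edges → ∃ v A, G.EdgeVertexCut S x y v A :=
    fun x y he => exists_edgeVertexCut hfin h2 hmin hc hcS he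
  have hdescent : ∀ n : ℕ, ∀ x y v A, s(x, y) ∈ c.edges → G.EdgeVertexCut S x y v A →
      (∀ s ∈ S, s ∈ c.support → s ∉ A) → ({z | z ∈ c.support} ∩ A).ncard = n → False := by
    intro n
    induction n using Nat.strong_induction_on with
    | _ n ih =>
    rintro x y v A he h hA rfl
    obtain ⟨x', y', v', A', he', h', hsub, hx⟩ := h.exists_smaller h2 hc hcut he hA
    refine ih _ ?_ x' y' v' A' he' h' (fun s hs hsc hsA => hA s hs hsc (hsub hsA)) rfl
    refine Set.ncard_lt_ncard ⟨Set.inter_subset_inter_right _ hsub, fun hss => hx ?_⟩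
      ((List.finite_toSet c.support).inter_of_left A)
    exact (hss ⟨c.fst_mem_support_of_mem_edges he, h.fst_mem⟩).2
  obtain ⟨x, y, he⟩ : ∃ x y, s(x, y) ∈ c.edges := by
    cases c with
    | nil => exact absurd hc (by simp)
    | cons h p => exact ⟨_, _, by rw [Walk.edges_cons]; exact List.mem_cons_self⟩
  obtain ⟨v, A, h⟩ := hcut x y he
  by_cases hA : ∀ s ∈ S, s ∈ c.support → s ∉ A
  · exact hdescent _ x y v A he h hA rfl
  · push Not at hA
    obtain ⟨s, hs, hsc, hsA⟩ := hA
    refine hdescent _ y x v _ (by rwa [Sym2.eq_swap]) h.swap (fun t ht htc htA => ?_) rfl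
    exact htA.1 (hcS s hs t ht hsc htc ▸ hsA)
end

section
/- Let G be a graph with nonnegative edge costs whose total cost is cost(G), containing a set of remaining terminals of total weight at least ℓ/(2⌈log₂ k⌉), and suppose G is 2-vertex-connected with at least 2 remaining terminals. If the density of G with respect to the remaining terminals is at most α = 2⌈log₂ k⌉·cost(G)/ℓ, then G contains a simple cycle with at least 2 remaining terminals of density at most α. -/
open SimpleGraph

/-- `IsSeg G x m y` says that `x, m, y` is the vertex sequence of a walk in `G`. -/
def IsSeg {V : Type*} (G : SimpleGraph V) : V → List V → V → Prop
  | x, [], y => G.Adj x y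
  | x, u :: m, y => G.Adj x u ∧ IsSeg G u m y

/-- The edges of the vertex sequence `x, m, y`. -/
def segEdges {V : Type*} : V → List V → V → List (Sym2 V)
  | x, [], y => [s(x, y)]
  | x, u :: m, y => s(x, u) :: segEdges u m y

/-- Total cost of the edges of the vertex sequence `x, m, y`. -/
def segCost {V : Type*} (c : Sym2 V → ℝ) : V → List V → V → ℝ
  | x, [], y => c s(x, y)
  | x, u :: m, y => c s(x, u) + segCost c u m y

section Segments

variable {V : Type*} {G : SimpleGraph V} {c : Sym2 V → ℝ}

theorem isSeg_append {x y z : V} {m n : List V} :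
    IsSeg G x (m ++ y :: n) z ↔ IsSeg G x m y ∧ IsSeg G y n z := by
  induction m generalizing x with
  | nil => simp [IsSeg]
  | cons u m ih => simp [IsSeg, ih, and_assoc]

theorem IsSeg.reverse {x y : V} {m : List V} (h : IsSeg G x m y) : IsSeg G y m.reverse x := by
  induction m generalizing x with
  | nil => exact G.adj_symm h
  | cons u m ih =>
    rw [List.reverse_cons, isSeg_append]
    exact ⟨ih h.2, G.adj_symm h.1⟩

theorem segCost_append {x y z : V} {m n : List V} :
    segCost c x (m ++ y :: n) z = segCost c x m y + segCost c y n z := by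
  induction m generalizing x with
  | nil => simp [segCost]
  | cons u m ih => simp [segCost, ih, add_assoc]

theorem segCost_reverse {x y : V} {m : List V} :
    segCost c y m.reverse x = segCost c x m y := by
  induction m generalizing x with
  | nil => simp [segCost, Sym2.eq_swap]
  | cons u m ih =>
    rw [List.reverse_cons, segCost_append, ih]
    simp [segCost, Sym2.eq_swap, add_comm]

theorem segCost_nonneg (hc : ∀ e, 0 ≤ c e) (x : V) (m : List V) (y : V) :
    0 ≤ segCost c x m y := by
  induction m generalizing x with
  | nil => exact hc _
  | cons u m ih => exact add_nonneg (hc _) (ih u)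

theorem segCost_eq_sum (x : V) (m : List V) (y : V) :
    segCost c x m y = ((segEdges x m y).map c).sum := by
  induction m generalizing x with
  | nil => simp [segCost, segEdges]
  | cons u m ih => simp [segCost, segEdges, ih]

theorem IsSeg.mem_edgeSet {x y : V} {m : List V} (h : IsSeg G x m y) :
    ∀ e ∈ segEdges x m y, e ∈ G.edgeSet := by
  induction m generalizing x with
  | nil => simpa [segEdges, IsSeg] using h
  | cons u m ih =>
    intro e he
    rcases List.mem_cons.1 he with rfl | he
    · exact h.1
    · exact ih h.2 e he

theorem mem_of_mem_segEdges {x y v : V} {m : List V} {e : Sym2 V} (he : e ∈ segEdges x m y)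
    (hv : v ∈ e) : v = x ∨ v ∈ m ∨ v = y := by
  induction m generalizing x with
  | nil =>
    simp only [segEdges, List.mem_singleton] at he
    subst he
    simpa using hv
  | cons u m ih =>
    rcases List.mem_cons.1 he with rfl | he
    · rcases Sym2.mem_iff.1 hv with h | h <;> simp [h]
    · rcases ih he with h | h | h <;> simp [h]

theorem exists_mem_of_mem_segEdges {x y : V} {m : List V} {e : Sym2 V} (hm : m ≠ [])
    (he : e ∈ segEdges x m y) : ∃ v ∈ m, v ∈ e := by
  induction m generalizing x with
  | nil => exact absurd rfl hm
  | cons u m ih =>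
    rcases List.mem_cons.1 he with rfl | he
    · exact ⟨u, by simp, by simp⟩
    · rcases m with _ | ⟨v, m⟩
      · simp only [segEdges, List.mem_singleton] at he
        exact ⟨u, by simp, by simp [he]⟩
      · obtain ⟨w, hw, hwe⟩ := ih (by simp) he
        exact ⟨w, List.mem_cons_of_mem _ hw, hwe⟩

theorem nodup_segEdges {x y : V} {m : List V} (hm : (x :: m).Nodup) (hy : y ∉ x :: m) :
    (segEdges x m y).Nodup := by
  induction m generalizing x with
  | nil => simp [segEdges]
  | cons u m ih =>
    refine List.nodup_cons.2 ⟨fun h => ?_, ih (by grind) (by grind)⟩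
    have := mem_of_mem_segEdges h (Sym2.mem_mk_left x u)
    grind

theorem closing_edge_notMem {x u : V} {m : List V} (hm : (x :: u :: m).Nodup) (hl : m ≠ []) :
    s(x, u) ∉ segEdges u m x := by
  rcases m with _ | ⟨v, m⟩
  · exact absurd rfl hl
  · intro h
    rcases List.mem_cons.1 h with h | h
    · grind [Sym2.eq_iff]
    · have := mem_of_mem_segEdges h (Sym2.mem_mk_right x u)
      grind

theorem nodup_segEdges_closed {x : V} {m : List V} (hm : (x :: m).Nodup) (hl : 2 ≤ m.length) :
    (segEdges x m x).Nodup := by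
  rcases m with _ | ⟨u, m⟩
  · simp at hl
  · refine List.nodup_cons.2 ⟨closing_edge_notMem hm ?_, nodup_segEdges (by grind) (by grind)⟩
    rintro rfl
    simp at hl

theorem IsSeg.exists_walk {x y : V} {m : List V} (h : IsSeg G x m y) :
    ∃ p : G.Walk x y, p.support = x :: (m ++ [y]) ∧ p.edges = segEdges x m y := by
  induction m generalizing x with
  | nil =>
    have h : G.Adj x y := h
    exact ⟨Walk.cons h Walk.nil, by simp, by simp [segEdges]⟩
  | cons u m ih =>
    obtain ⟨p, hp, he⟩ := ih h.2
    exact ⟨Walk.cons h.1 p, by simp [hp], by simp [he, segEdges]⟩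

theorem IsSeg.exists_isCycle {x : V} {m : List V} (h : IsSeg G x m x) (hm : (x :: m).Nodup)
    (hl : 2 ≤ m.length) :
    ∃ X : G.Walk x x, X.IsCycle ∧ (∀ v, v ∈ X.support ↔ v ∈ x :: m) ∧
      wcost c X = segCost c x m x := by
  rcases m with _ | ⟨u, m⟩
  · simp at hl
  · obtain ⟨p, hp, he⟩ := h.2.exists_walk
    refine ⟨Walk.cons h.1 p, ?_, fun v => ?_, ?_⟩
    · rw [Walk.cons_isCycle_iff, Walk.isPath_def, hp, he]
      refine ⟨by grind, closing_edge_notMem hm ?_⟩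
      rintro rfl
      simp at hl
    · simp only [Walk.support_cons, hp]
      grind
    · rw [wcost, segCost_eq_sum, Walk.edges_cons, he]
      rfl

end Segments

section Ears

variable {V : Type*} {G : SimpleGraph V}

/-- `x, m, y` is a path of `G` with distinct ends in `A` and no interior vertex in `A`. -/
def IsEar (G : SimpleGraph V) (A : Finset V) (x : V) (m : List V) (y : V) : Prop :=
  IsSeg G x m y ∧ x ∈ A ∧ y ∈ A ∧ x ≠ y ∧ m.Nodup ∧ ∀ v ∈ m, v ∉ A

theorem IsEar.reverse {A : Finset V} {x y : V} {m : List V} (h : IsEar G A x m y) :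
    IsEar G A y m.reverse x := by
  obtain ⟨h1, h2, h3, h4, h5, h6⟩ := h
  exact ⟨h1.reverse, h3, h2, h4.symm, by simpa using h5, by simpa using h6⟩

theorem exists_first_hit {v x z : V} {B : Set V}
    (h : Relation.ReflTransGen (fun a b => G.Adj a b ∧ a ≠ v ∧ b ≠ v) x z)
    (hz : z ∈ B) (hx : x ∉ B) :
    ∃ r y, IsSeg G x r y ∧ y ∈ B ∧ y ≠ v ∧ (x :: r).Nodup ∧ ∀ u ∈ x :: r, u ∉ B ∧ u ≠ v := by
  induction h using Relation.ReflTransGen.head_induction_on with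
  | refl => exact absurd hz hx
  | @head x x' hxx' _ ih =>
    by_cases hx' : x' ∈ B
    · exact ⟨[], x', hxx'.1, hx', hxx'.2.2, by simp, by simp [hx, hxx'.2.1]⟩
    · obtain ⟨r, y, h1, h2, h3, h4, h5⟩ := ih hx'
      by_cases hm : x ∈ r
      · obtain ⟨r1, r2, rfl⟩ := List.append_of_mem hm
        exact ⟨r2, y, (isSeg_append.1 h1).2, h2, h3, by grind, by grind⟩
      · have hne : x ≠ x' := hxx'.1.ne
        exact ⟨x' :: r, y, ⟨hxx'.1, h1⟩, h2, h3, by grind, by grind⟩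

theorem exists_ear_of_hit {A : Finset V} {a b x y z : V} {m n r : List V}
    (he : IsEar G A a (m ++ x :: n) b) (hxy : G.Adj x y) (hr : IsSeg G y r z)
    (hnd : (y :: r).Nodup) (hdis : ∀ u ∈ y :: r, u ∉ A ∧ u ∉ m ∧ u ∉ n ∧ u ≠ x)
    (hz : (z ∈ A ∧ z ≠ a) ∨ z ∈ n) :
    ∃ a m b, IsEar G A a m b ∧ y ∈ m := by
  obtain ⟨h1, h2, h3, h4, h5, h6⟩ := he
  rw [isSeg_append] at h1
  rcases hz with ⟨hz, hza⟩ | hz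
  · refine ⟨a, m ++ x :: y :: r, z, ⟨isSeg_append.2 ⟨h1.1, hxy, hr⟩, h2, hz, hza.symm, ?_, ?_⟩,
      by simp⟩
    · grind
    · grind
  · obtain ⟨n1, n2, rfl⟩ := List.append_of_mem hz
    refine ⟨a, m ++ x :: ((y :: r) ++ z :: n2), b,
      ⟨isSeg_append.2 ⟨h1.1, hxy, isSeg_append.2 ⟨hr, (isSeg_append.1 h1.2).2⟩⟩, h2, h3, h4, ?_, ?_⟩,
      by simp⟩
    · grind
    · grind

/-- In a graph that stays connected after deleting any vertex, every vertex outside a set `A` with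
at least two vertices lies on an ear of `A`. -/
theorem exists_ear_through [DecidableEq V]
    (hconn : ∀ v : V, (G.induce {w | w ≠ v}).Connected) {A : Finset V} (hA : 2 ≤ A.card)
    {t : V} (ht : t ∉ A) : ∃ a m b, IsEar G A a m b ∧ t ∈ m := by
  have hreach : ∀ v x y : V, x ≠ v → y ≠ v →
      Relation.ReflTransGen (fun a b => G.Adj a b ∧ a ≠ v ∧ b ≠ v) x y := by
    intro v x y hx hy
    have := (hconn v).preconnected ⟨x, hx⟩ ⟨y, hy⟩
    rw [SimpleGraph.reachable_iff_reflTransGen] at this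
    exact Relation.ReflTransGen.lift (p := fun a b => G.Adj a b ∧ a ≠ v ∧ b ≠ v) Subtype.val
      (fun a b hab => ⟨hab, a.2, b.2⟩) _ _ this
  obtain ⟨a₀, ha₀, b₀, hb₀, hab₀⟩ := Finset.one_lt_card.1 hA
  have hwalk := hreach b₀ t a₀ (by grind) hab₀
  clear hab₀ hb₀
  induction hwalk using Relation.ReflTransGen.head_induction_on with
  | refl => exact absurd ha₀ ht
  | @head y x hyx _ ih =>
    by_cases hx : x ∈ A
    · obtain ⟨z₀, hz₀, hz₀x⟩ := Finset.exists_mem_ne hA x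
      obtain ⟨r, z, h1, h2, h3, h4, h5⟩ := exists_first_hit (B := {v | v ∈ A ∧ v ≠ x})
        (hreach x y z₀ hyx.1.ne hz₀x) ⟨hz₀, hz₀x⟩ (fun h => ht h.1)
      exact ⟨x, y :: r, z, ⟨⟨hyx.1.symm, h1⟩, hx, h2.1, h3.symm, h4, by grind⟩, by simp⟩
    · obtain ⟨a, m, b, he, hxm⟩ := ih hx
      by_cases hym : y ∈ m
      · exact ⟨a, m, b, he, hym⟩
      obtain ⟨m, n, rfl⟩ := List.append_of_mem hxm
      have hax : a ≠ x := by rintro rfl; exact hx he.2.1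
      obtain ⟨r, z, h1, h2, h3, h4, h5⟩ := exists_first_hit
        (B := {v | (v ∈ A ∨ v ∈ m ∨ v ∈ n) ∧ v ≠ x})
        (hreach x y a hyx.1.ne hax) ⟨Or.inl he.2.1, hax⟩ (by grind)
      have hrev : IsEar G A b (n.reverse ++ x :: m.reverse) a := by
        simpa using he.reverse
      have hab : a ≠ b := he.2.2.2.1
      by_cases hz : (z ∈ A ∧ z ≠ a) ∨ z ∈ n
      · exact exists_ear_of_hit he hyx.1.symm h1 h4 (by grind) hz
      · exact exists_ear_of_hit hrev hyx.1.symm h1 h4 (by grind) (by grind)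

end Ears

section LowDensity

variable {V : Type*} {G : SimpleGraph V} {c : Sym2 V → ℝ} {ω : V → ℝ} {S : Finset V}

/-- Total weight of a list of vertices. -/
def listWeight (ω : V → ℝ) (m : List V) : ℝ := (m.map ω).sum

/-- `x, m, x` is a cycle of `G` containing at least two vertices of `S`. -/
def IsNontrivialCycle_s17 (G : SimpleGraph V) (S : Finset V) (x : V) (m : List V) : Prop :=
  IsSeg G x m x ∧ (x :: m).Nodup ∧ 2 ≤ m.length ∧
    ∃ s ∈ S, ∃ t ∈ S, s ≠ t ∧ s ∈ x :: m ∧ t ∈ x :: m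

theorem listWeight_cons (v : V) (m : List V) :
    listWeight ω (v :: m) = ω v + listWeight ω m := by
  simp [listWeight]

theorem listWeight_append (m n : List V) :
    listWeight ω (m ++ n) = listWeight ω m + listWeight ω n := by
  simp [listWeight]

theorem listWeight_reverse (m : List V) : listWeight ω m.reverse = listWeight ω m := by
  simp [listWeight, List.sum_reverse]

theorem nodup_reverse_arc {x y : V} {q m : List V} :
    (x :: (q ++ y :: m.reverse)).Nodup ↔ (x :: (q ++ y :: m)).Nodup := by
  simp [List.nodup_append]

theorem listWeight_eq_zero (hS : ∀ v ∉ S, ω v = 0) {m : List V} (hm : ∀ v ∈ m, v ∉ S) :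
    listWeight ω m = 0 := by
  refine List.sum_eq_zero fun r hr => ?_
  obtain ⟨v, hv, rfl⟩ := List.mem_map.1 hr
  exact hS v (hm v hv)

/-- If all nontrivial cycles cost at least their weight, then a path through a terminal costs at
least its interior weight as soon as its surplus is at least that of a parallel path. -/
theorem listWeight_le_segCost_of_parallel (hc : ∀ e, 0 ≤ c e) (hω : ∀ v, 0 ≤ ω v)
    (hS : ∀ v ∉ S, ω v = 0)
    (hcyc : ∀ x m, IsNontrivialCycle_s17 G S x m → listWeight ω (x :: m) ≤ segCost c x m x)
    {x y : V} {q m : List V} (hq : IsSeg G x q y) (hm : IsSeg G x m y)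
    (hnd : (x :: (q ++ y :: m)).Nodup) (hqS : ∃ t ∈ q, t ∈ S)
    (hle : segCost c x m y - listWeight ω m ≤ segCost c x q y - listWeight ω q) :
    listWeight ω q ≤ segCost c x q y := by
  by_cases hmS : ∃ t ∈ m, t ∈ S
  · obtain ⟨s, hsq, hs⟩ := hqS
    obtain ⟨t, htm, ht⟩ := hmS
    have h := hcyc x (q ++ y :: m.reverse) ⟨isSeg_append.2 ⟨hq, hm.reverse⟩, by grind, by grind,
      s, hs, t, ht, by grind, by grind, by grind⟩
    simp only [listWeight_cons, listWeight_append, listWeight_reverse, segCost_append,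
      segCost_reverse] at h
    linarith [hω x, hω y]
  · have h0 := listWeight_eq_zero hS (m := m) (by grind)
    linarith [segCost_nonneg hc x m y]

/-- All ears of `A` through a terminal cost at least their interior weight. -/
def EarsExpensive (G : SimpleGraph V) (c : Sym2 V → ℝ) (ω : V → ℝ) (S A : Finset V) : Prop :=
  ∀ x m y, IsEar G A x m y → (∃ t ∈ m, t ∈ S) → listWeight ω m ≤ segCost c x m y

/-- The vertex set of a nontrivial cycle of minimum surplus has only expensive ears. -/
theorem earsExpensive_of_minimal_cycle [DecidableEq V] (hc : ∀ e, 0 ≤ c e) (hω : ∀ v, 0 ≤ ω v)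
    (hS : ∀ v ∉ S, ω v = 0)
    (hcyc : ∀ x m, IsNontrivialCycle_s17 G S x m → listWeight ω (x :: m) ≤ segCost c x m x)
    {z : V} {l : List V} (hl : IsNontrivialCycle_s17 G S z l)
    (hmin : ∀ x m, IsNontrivialCycle_s17 G S x m →
      segCost c z l z - listWeight ω (z :: l) ≤ segCost c x m x - listWeight ω (x :: m)) :
    EarsExpensive G c ω S (z :: l).toFinset := by
  rintro x q y ⟨hq, hx, hy, hxy, hqn, hqd⟩ ⟨t, htq, htS⟩
  simp only [List.mem_toFinset] at hx hy hqd
  obtain ⟨m, n, hm, hn, hnd, hsub, hsum⟩ : ∃ m n, IsSeg G x m y ∧ IsSeg G y n x ∧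
      (x :: (m ++ y :: n)).Nodup ∧ (∀ v, v ∈ z :: l ↔ v ∈ x :: (m ++ y :: n)) ∧
      segCost c z l z - listWeight ω (z :: l) =
        segCost c x m y + segCost c y n x
          - (ω x + listWeight ω m + ω y + listWeight ω n) := by
    obtain ⟨h1, h2, -⟩ := hl
    obtain ⟨l', h1', h2', hiff, hsum'⟩ : ∃ l', IsSeg G x l' x ∧ (x :: l').Nodup ∧
        (∀ v, v ∈ z :: l ↔ v ∈ x :: l') ∧ segCost c z l z - listWeight ω (z :: l) =
          segCost c x l' x - listWeight ω (x :: l') := by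
      rcases List.mem_cons.1 hx with rfl | hx
      · exact ⟨l, h1, h2, fun _ => Iff.rfl, rfl⟩
      · obtain ⟨l1, l2, rfl⟩ := List.append_of_mem hx
        rw [isSeg_append] at h1
        refine ⟨l2 ++ z :: l1, isSeg_append.2 h1.symm, by grind, by grind, ?_⟩
        simp only [listWeight_cons, listWeight_append, segCost_append]
        ring
    have hyl : y ∈ l' := by grind
    obtain ⟨m, n, rfl⟩ := List.append_of_mem hyl
    rw [isSeg_append] at h1'
    refine ⟨m, n, h1'.1, h1'.2, h2', hiff, ?_⟩
    rw [hsum']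
    simp only [listWeight_cons, listWeight_append, segCost_append]
    ring
  obtain ⟨-, -, -, s, hs, -, -, -, hsl, -⟩ := hl
  have hqd' : ∀ v ∈ q, v ∉ x :: (m ++ y :: n) := by grind
  have hsl' := (hsub s).1 hsl
  by_cases hsm : s ∈ m
  · refine listWeight_le_segCost_of_parallel hc hω hS hcyc hq hn.reverse
      (nodup_reverse_arc.2 (by grind))
      ⟨t, htq, htS⟩ ?_
    have h := hmin x (m ++ y :: q.reverse) ⟨isSeg_append.2 ⟨hm, hq.reverse⟩, by grind, by grind,
      s, hs, t, htS, by grind, by grind, by grind⟩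
    rw [hsum] at h
    simp only [listWeight_cons, listWeight_append, segCost_append, segCost_reverse,
      listWeight_reverse] at h ⊢
    linarith
  · refine listWeight_le_segCost_of_parallel hc hω hS hcyc hq hm (by grind) ⟨t, htq, htS⟩ ?_
    have h := hmin x (q ++ y :: n) ⟨isSeg_append.2 ⟨hq, hn⟩, by grind, by grind,
      s, hs, t, htS, by grind, by grind, by grind⟩
    rw [hsum] at h
    simp only [listWeight_cons, listWeight_append, segCost_append] at h ⊢
    linarith

theorem segCost_sub_le_of_attach {A : Finset V} {δ : ℝ}
    (hmin : ∀ x m y, IsEar G A x m y → (∃ t ∈ m, t ∈ S) → δ ≤ segCost c x m y - listWeight ω m)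
    {a b x y : V} {m n q : List V} (hp : IsEar G A a (m ++ x :: n) b)
    (hδ : segCost c a (m ++ x :: n) b - listWeight ω (m ++ x :: n) = δ)
    (hq : IsSeg G x q y) (hqS : ∃ t ∈ q, t ∈ S) (hqn : q.Nodup)
    (hqd : ∀ v ∈ q, v ∉ A ∧ v ∉ m ++ x :: n) (hy : y ∈ A) (hya : y ≠ a) :
    segCost c x n b - listWeight ω n ≤ segCost c x q y - listWeight ω q := by
  obtain ⟨h1, h2, h3, h4, h5, h6⟩ := hp
  obtain ⟨t, htq, htS⟩ := hqS
  have h := hmin a (m ++ x :: q) y ⟨isSeg_append.2 ⟨(isSeg_append.1 h1).1, hq⟩, h2, hy, hya.symm,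
    by grind, by grind⟩ ⟨t, by grind, htS⟩
  simp only [listWeight_cons, listWeight_append, segCost_append] at h hδ
  linarith

theorem listWeight_le_segCost_of_attach (hc : ∀ e, 0 ≤ c e) (hω : ∀ v, 0 ≤ ω v)
    (hS : ∀ v ∉ S, ω v = 0)
    (hcyc : ∀ x m, IsNontrivialCycle_s17 G S x m → listWeight ω (x :: m) ≤ segCost c x m x)
    {A : Finset V} {δ : ℝ} (hδ0 : 0 ≤ δ)
    (hmin : ∀ x m y, IsEar G A x m y → (∃ t ∈ m, t ∈ S) → δ ≤ segCost c x m y - listWeight ω m)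
    {a b x y : V} {p q : List V} (hp : IsEar G A a p b)
    (hδ : segCost c a p b - listWeight ω p = δ)
    (hq : IsSeg G x q y) (hqS : ∃ t ∈ q, t ∈ S) (hqn : q.Nodup)
    (hqd : ∀ v ∈ q, v ∉ A ∧ v ∉ p) (hx : x ∈ p) (hy : y ∈ A) :
    listWeight ω q ≤ segCost c x q y := by
  obtain ⟨m, n, rfl⟩ := List.append_of_mem hx
  have hrev : IsEar G A b (n.reverse ++ x :: m.reverse) a := by simpa using hp.reverse
  have hδrev : segCost c b (n.reverse ++ x :: m.reverse) a
      - listWeight ω (n.reverse ++ x :: m.reverse) = δ := by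
    rw [← hδ]
    simp only [listWeight_cons, listWeight_append, segCost_append, segCost_reverse,
      listWeight_reverse]
    ring
  have hfwd := segCost_sub_le_of_attach hmin hp hδ hq hqS hqn hqd hy
  have hbwd := segCost_sub_le_of_attach hmin hrev hδrev hq hqS hqn (by grind) hy
  obtain ⟨h1, h2, h3, h4, h5, h6⟩ := hp
  rw [isSeg_append] at h1
  by_cases hya : y = a
  · subst hya
    exact listWeight_le_segCost_of_parallel hc hω hS hcyc hq h1.1.reverse
      (nodup_reverse_arc.2 (by grind)) hqS (hbwd h4)
  by_cases hyb : y = b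
  · subst hyb
    exact listWeight_le_segCost_of_parallel hc hω hS hcyc hq h1.2 (by grind) hqS (hfwd hya)
  have hf := hfwd hya
  have hb := hbwd hyb
  simp only [listWeight_cons, listWeight_append, segCost_append, segCost_reverse,
    listWeight_reverse] at hf hb hδ
  linarith [hω x]

theorem listWeight_le_segCost_of_shortcut (hc : ∀ e, 0 ≤ c e) (hω : ∀ v, 0 ≤ ω v)
    (hS : ∀ v ∉ S, ω v = 0)
    (hcyc : ∀ x m, IsNontrivialCycle_s17 G S x m → listWeight ω (x :: m) ≤ segCost c x m x)
    {A : Finset V} {δ : ℝ}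
    (hmin : ∀ x m y, IsEar G A x m y → (∃ t ∈ m, t ∈ S) → δ ≤ segCost c x m y - listWeight ω m)
    {a b x y : V} {m n r q : List V} (hp : IsEar G A a (m ++ x :: (n ++ y :: r)) b)
    (hδ : segCost c a (m ++ x :: (n ++ y :: r)) b
      - listWeight ω (m ++ x :: (n ++ y :: r)) = δ)
    (hq : IsSeg G x q y) (hqS : ∃ t ∈ q, t ∈ S) (hqn : q.Nodup)
    (hqd : ∀ v ∈ q, v ∉ A ∧ v ∉ m ++ x :: (n ++ y :: r)) :
    listWeight ω q ≤ segCost c x q y := by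
  obtain ⟨h1, h2, h3, h4, h5, h6⟩ := hp
  rw [isSeg_append, isSeg_append] at h1
  refine listWeight_le_segCost_of_parallel hc hω hS hcyc hq h1.2.1 (by grind) hqS ?_
  obtain ⟨t, htq, htS⟩ := hqS
  have h := hmin a (m ++ x :: (q ++ y :: r)) b
    ⟨isSeg_append.2 ⟨h1.1, isSeg_append.2 ⟨hq, h1.2.2⟩⟩, h2, h3, h4, by grind, by grind⟩
    ⟨t, by grind, htS⟩
  simp only [listWeight_cons, listWeight_append, segCost_append] at h hδ
  linarith

/-- Adding a terminal ear of minimum surplus keeps all ears expensive. -/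
theorem EarsExpensive.union_minimal_ear [DecidableEq V] (hc : ∀ e, 0 ≤ c e) (hω : ∀ v, 0 ≤ ω v)
    (hS : ∀ v ∉ S, ω v = 0)
    (hcyc : ∀ x m, IsNontrivialCycle_s17 G S x m → listWeight ω (x :: m) ≤ segCost c x m x)
    {A : Finset V} (hA : EarsExpensive G c ω S A)
    {a b : V} {p : List V} (hp : IsEar G A a p b) (hpS : ∃ t ∈ p, t ∈ S)
    (hmin : ∀ x m y, IsEar G A x m y → (∃ t ∈ m, t ∈ S) →
      segCost c a p b - listWeight ω p ≤ segCost c x m y - listWeight ω m) :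
    EarsExpensive G c ω S (A ∪ p.toFinset) := by
  have hp0 : 0 ≤ segCost c a p b - listWeight ω p := sub_nonneg.2 (hA a p b hp hpS)
  rintro x q y ⟨hq, hx, hy, hxy, hqn, hqd⟩ hqS
  simp only [Finset.mem_union, List.mem_toFinset, not_or] at hx hy hqd
  have hqSr : ∃ t ∈ q.reverse, t ∈ S := by simpa using hqS
  have hqnr : q.reverse.Nodup := by simpa using hqn
  have hqdr : ∀ v ∈ q.reverse, v ∉ A ∧ v ∉ p := by simpa using hqd
  rcases hx with hx | hx <;> rcases hy with hy | hy
  · exact hA x q y ⟨hq, hx, hy, hxy, hqn, fun v hv => (hqd v hv).1⟩ hqS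
  · rw [← listWeight_reverse, ← segCost_reverse]
    exact listWeight_le_segCost_of_attach hc hω hS hcyc hp0 hmin hp rfl hq.reverse hqSr hqnr hqdr
      hy hx
  · exact listWeight_le_segCost_of_attach hc hω hS hcyc hp0 hmin hp rfl hq hqS hqn hqd hx hy
  · obtain ⟨m, n, rfl⟩ := List.append_of_mem hx
    by_cases hyn : y ∈ n
    · obtain ⟨n, r, rfl⟩ := List.append_of_mem hyn
      exact listWeight_le_segCost_of_shortcut hc hω hS hcyc hmin hp rfl hq hqS hqn hqd
    · have hym : y ∈ m := by grind
      obtain ⟨m, r, rfl⟩ := List.append_of_mem hym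
      rw [← listWeight_reverse, ← segCost_reverse]
      simp only [List.append_assoc, List.cons_append] at hp hmin hqdr
      exact listWeight_le_segCost_of_shortcut hc hω hS hcyc hmin hp rfl hq.reverse hqSr hqnr hqdr

theorem exists_nontrivialCycle [Fintype V] [DecidableEq V] (hG : Graph2Conn G)
    (hScard : 2 ≤ S.card) : ∃ x m, IsNontrivialCycle_s17 G S x m := by
  obtain ⟨s, hs, t, ht, hst⟩ := Finset.one_lt_card.1 hScard
  obtain ⟨r, hr⟩ : ∃ r, r ∉ ({s, t} : Finset V) := by
    by_contra! h
    have h1 := Finset.card_le_card (fun v _ => h v : (Finset.univ : Finset V) ⊆ {s, t})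
    have h2 := hG.1
    rw [Nat.card_eq_fintype_card] at h2
    have h3 := Finset.card_le_two (a := s) (b := t)
    rw [Finset.card_univ] at h1
    omega
  obtain ⟨u, hsu, hut⟩ : ∃ u, G.Adj s u ∧ u ≠ t := by
    have : Nontrivial {w | w ≠ t} := ⟨⟨s, hst⟩, ⟨r, by grind⟩, by grind⟩
    obtain ⟨u, hu⟩ := (hG.2 t).preconnected.exists_adj_of_nontrivial ⟨s, hst⟩
    exact ⟨u, hu, u.2⟩
  have hne := hsu.ne
  obtain ⟨a, m, b, ⟨h1, h2, h3, h4, h5, h6⟩, htm⟩ := exists_ear_through hG.2 (A := {s, u})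
    (Finset.card_pair hne).ge (t := t) (by grind)
  have hab : (a = s ∧ b = u) ∨ (a = u ∧ b = s) := by grind
  have hadj : G.Adj b a := by
    rcases hab with ⟨rfl, rfl⟩ | ⟨rfl, rfl⟩
    · exact hsu.symm
    · exact hsu
  refine ⟨a, m ++ [b], isSeg_append.2 ⟨h1, hadj⟩, by grind, ?_, s, hs, t, ht, hst, by grind,
    by grind⟩
  have := List.length_pos_of_mem htm
  simp
  omega

theorem listWeight_eq_sum [DecidableEq V] {m : List V} (hm : m.Nodup) :
    listWeight ω m = ∑ v ∈ m.toFinset, ω v :=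
  (List.sum_toFinset ω hm).symm

theorem segCost_eq_sum_toFinset [DecidableEq V] {x y : V} {m : List V}
    (h : (segEdges x m y).Nodup) :
    segCost c x m y = ∑ e ∈ (segEdges x m y).toFinset, c e := by
  rw [segCost_eq_sum, List.sum_toFinset c h]

theorem finite_setOf_nodup [Fintype V] : {l : V × List V × V | l.2.1.Nodup}.Finite := by
  classical
  have h : {m : List V | m.Nodup}.Finite :=
    Set.finite_coe_iff.1 (inferInstanceAs (Finite {m : List V // m.Nodup}))
  exact (Set.finite_univ.prod (h.prod Set.finite_univ)).subset fun l hl => by simpa using hl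

/-- Ear-by-ear growth: a vertex set whose spanned edges cost more than its weight and all of whose
ears are expensive forces the whole graph to cost more than the terminals weigh. -/
theorem sum_lt_sum_of_earsExpensive [Fintype V] [DecidableEq V] [DecidableRel G.Adj]
    (hconn : ∀ v : V, (G.induce {w | w ≠ v}).Connected)
    (hc : ∀ e, 0 ≤ c e) (hω : ∀ v, 0 ≤ ω v) (hS : ∀ v ∉ S, ω v = 0)
    (hcyc : ∀ x m, IsNontrivialCycle_s17 G S x m → listWeight ω (x :: m) ≤ segCost c x m x)
    (A : Finset V) (hA2 : 2 ≤ A.card) (hA : EarsExpensive G c ω S A)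
    (hlt : ∑ v ∈ A, ω v < ∑ e ∈ G.edgeFinset ∩ A.sym2, c e) :
    ∑ v ∈ S, ω v < ∑ e ∈ G.edgeFinset, c e := by
  by_cases hSA : S ⊆ A
  · calc ∑ v ∈ S, ω v ≤ ∑ v ∈ A, ω v :=
          Finset.sum_le_sum_of_subset_of_nonneg hSA fun v _ _ => hω v
      _ < _ := hlt
      _ ≤ _ := Finset.sum_le_sum_of_subset_of_nonneg Finset.inter_subset_left fun e _ _ => hc e
  obtain ⟨t, htS, htA⟩ := Finset.not_subset.1 hSA
  obtain ⟨a₀, p₀, b₀, hp₀, htp₀⟩ := exists_ear_through hconn hA2 htA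
  obtain ⟨⟨a, p, b⟩, ⟨hp, hpS⟩, hmin⟩ := Set.exists_min_image
    {l : V × List V × V | IsEar G A l.1 l.2.1 l.2.2 ∧ ∃ t ∈ l.2.1, t ∈ S}
    (fun l => segCost c l.1 l.2.1 l.2.2 - listWeight ω l.2.1)
    (finite_setOf_nodup.subset fun l hl => hl.1.2.2.2.2.1) ⟨(a₀, p₀, b₀), hp₀, t, htp₀, htS⟩
  obtain ⟨h1, h2, h3, h4, h5, h6⟩ := id hp
  obtain ⟨s, hsp, hsS⟩ := id hpS
  have hssub : A ⊂ A ∪ p.toFinset := by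
    refine Finset.ssubset_iff_subset_ne.2 ⟨Finset.subset_union_left, fun h => h6 s hsp ?_⟩
    rw [h]
    simp [hsp]
  refine sum_lt_sum_of_earsExpensive hconn hc hω hS hcyc (A ∪ p.toFinset)
    (hA2.trans (Finset.card_le_card hssub.1))
    (hA.union_minimal_ear hc hω hS hcyc hp hpS fun x m y h h' => hmin (x, m, y) ⟨h, h'⟩) ?_
  have hdisj : Disjoint A p.toFinset := by
    rw [Finset.disjoint_right]
    simpa using h6
  have hdisj' : Disjoint (G.edgeFinset ∩ A.sym2) (segEdges a p b).toFinset := by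
    rw [Finset.disjoint_right]
    intro e he he'
    obtain ⟨v, hv, hve⟩ := exists_mem_of_mem_segEdges (List.ne_nil_of_mem hsp)
      (List.mem_toFinset.1 he)
    exact h6 v hv (Finset.mem_sym2_iff.1 (Finset.mem_inter.1 he').2 v hve)
  have hsub : (G.edgeFinset ∩ A.sym2) ∪ (segEdges a p b).toFinset ⊆
      G.edgeFinset ∩ (A ∪ p.toFinset).sym2 := by
    refine Finset.union_subset
      (Finset.inter_subset_inter_left (Finset.sym2_mono Finset.subset_union_left)) fun e he => ?_
    rw [List.mem_toFinset] at he
    refine Finset.mem_inter.2 ⟨mem_edgeFinset.2 (h1.mem_edgeSet e he), ?_⟩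
    rw [Finset.mem_sym2_iff]
    intro v hv
    rcases mem_of_mem_segEdges he hv with rfl | h | rfl <;> simp_all
  have hle := hA a p b hp hpS
  rw [listWeight_eq_sum h5, segCost_eq_sum_toFinset (nodup_segEdges (by grind) (by grind))] at hle
  calc ∑ v ∈ A ∪ p.toFinset, ω v = ∑ v ∈ A, ω v + ∑ v ∈ p.toFinset, ω v :=
        Finset.sum_union hdisj
    _ < ∑ e ∈ G.edgeFinset ∩ A.sym2, c e + ∑ e ∈ (segEdges a p b).toFinset, c e :=
        add_lt_add_of_lt_of_le hlt hle
    _ = ∑ e ∈ (G.edgeFinset ∩ A.sym2) ∪ (segEdges a p b).toFinset, c e :=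
        (Finset.sum_union hdisj').symm
    _ ≤ _ := Finset.sum_le_sum_of_subset_of_nonneg hsub fun e _ _ => hc e
termination_by Aᶜ.card
decreasing_by exact Finset.card_lt_card (Finset.compl_ssubset_compl.2 hssub)

/-- If every nontrivial cycle costs more than its weight, so does the whole graph. -/
theorem sum_lt_sum_of_nontrivialCycle [Fintype V] [DecidableEq V] [DecidableRel G.Adj]
    (hG : Graph2Conn G) (hScard : 2 ≤ S.card)
    (hc : ∀ e, 0 ≤ c e) (hω : ∀ v, 0 ≤ ω v) (hS : ∀ v ∉ S, ω v = 0)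
    (hcyc : ∀ x m, IsNontrivialCycle_s17 G S x m → listWeight ω (x :: m) < segCost c x m x) :
    ∑ v ∈ S, ω v < ∑ e ∈ G.edgeFinset, c e := by
  obtain ⟨x₀, m₀, h₀⟩ := exists_nontrivialCycle hG hScard
  obtain ⟨⟨z, l, z'⟩, ⟨hl, -⟩, hmin⟩ := Set.exists_min_image
    {l : V × List V × V | IsNontrivialCycle_s17 G S l.1 l.2.1 ∧ l.2.2 = l.1}
    (fun l => segCost c l.1 l.2.1 l.1 - listWeight ω (l.1 :: l.2.1))
    (finite_setOf_nodup.subset fun l hl => hl.1.2.1.of_cons) ⟨(x₀, m₀, x₀), h₀, rfl⟩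
  have hle : ∀ x m, IsNontrivialCycle_s17 G S x m → listWeight ω (x :: m) ≤ segCost c x m x :=
    fun x m h => (hcyc x m h).le
  have hA := earsExpensive_of_minimal_cycle hc hω hS hle hl
    fun x m h => hmin (x, m, x) ⟨h, rfl⟩
  have hlt := hcyc z l hl
  obtain ⟨h1, h2, h3, -⟩ := hl
  refine sum_lt_sum_of_earsExpensive hG.2 hc hω hS hle _ ?_ hA ?_
  · rw [List.toFinset_card_of_nodup h2, List.length_cons]
    omega
  · rw [listWeight_eq_sum h2, segCost_eq_sum_toFinset (nodup_segEdges_closed h2 h3)] at hlt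
    refine hlt.trans_le (Finset.sum_le_sum_of_subset_of_nonneg (fun e he => ?_) fun e _ _ => hc e)
    rw [List.mem_toFinset] at he
    refine Finset.mem_inter.2 ⟨mem_edgeFinset.2 (h1.mem_edgeSet e he), ?_⟩
    rw [Finset.mem_sym2_iff]
    intro v hv
    rcases mem_of_mem_segEdges he hv with rfl | h | rfl <;> simp_all

end LowDensity

theorem good_cycle_exists_during_merging
    {V : Type*} [Fintype V] [DecidableEq V] (G : SimpleGraph V) [DecidableRel G.Adj]
    (hG : Graph2Conn G)
    (c : Sym2 V → ℝ) (hc : ∀ e, 0 ≤ c e)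
    -- S is the set of remaining terminals, with positive weights
    (S : Finset V) (hScard : 2 ≤ S.card)
    (w : V → ℝ) (hw : ∀ s ∈ S, 0 < w s)
    (k : ℕ) (hk : 2 ≤ k) (ℓ : ℝ) (hℓ : 0 < ℓ)
    -- remaining terminal weight is at least ℓ/(2⌈log₂ k⌉)
    (hweight : ℓ / (2 * (Nat.clog 2 k : ℝ)) ≤ ∑ t ∈ S, w t)
    -- density of G w.r.t. remaining terminals is at most α = 2⌈log₂ k⌉·cost(G)/ℓ
    (hdens : (∑ e ∈ G.edgeFinset, c e) / (∑ t ∈ S, w t) ≤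
      2 * (Nat.clog 2 k : ℝ) * (∑ e ∈ G.edgeFinset, c e) / ℓ) :
    ∃ (x : V) (X : G.Walk x x), X.IsCycle ∧
      (∃ t1 ∈ S, ∃ t2 ∈ S, t1 ≠ t2 ∧ t1 ∈ X.support ∧ t2 ∈ X.support) ∧
      wcost c X / (∑ t ∈ S.filter (· ∈ X.support), w t) ≤
        2 * (Nat.clog 2 k : ℝ) * (∑ e ∈ G.edgeFinset, c e) / ℓ := by
  
  have hSpos : 0 < ∑ t ∈ S, w t :=
    Finset.sum_pos hw (Finset.card_pos.1 (by omega))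
  by_contra! hno
  set D := (∑ e ∈ G.edgeFinset, c e) / (∑ t ∈ S, w t) with hD
  have hD0 : 0 ≤ D := div_nonneg (Finset.sum_nonneg fun e _ => hc e) hSpos.le
  have hlt := sum_lt_sum_of_nontrivialCycle (ω := fun v => if v ∈ S then D * w v else 0)
    hG hScard hc
    (fun v => by
      split_ifs with h
      · exact mul_nonneg hD0 (hw v h).le
      · exact le_rfl)
    (fun v hv => if_neg hv)
    (fun x m hm => by
      obtain ⟨h1, h2, h3, s, hs, t, ht, hst, hsm, htm⟩ := hm
      obtain ⟨X, hX, hsupp, hcost⟩ := h1.exists_isCycle (c := c) h2 h3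
      have h := hdens.trans_lt (hno x X hX
        ⟨s, hs, t, ht, hst, (hsupp s).2 hsm, (hsupp t).2 htm⟩)
      have hfilter : S.filter (· ∈ X.support) = (x :: m).toFinset.filter (· ∈ S) := by
        ext v
        simp only [Finset.mem_filter, hsupp, List.mem_toFinset]
        exact and_comm
      have hpos : 0 < ∑ t ∈ S.filter (· ∈ X.support), w t :=
        Finset.sum_pos (fun v hv => hw v (Finset.mem_filter.1 hv).1)
          ⟨s, Finset.mem_filter.2 ⟨hs, (hsupp s).2 hsm⟩⟩
      rw [lt_div_iff₀ hpos, hcost, hfilter, Finset.mul_sum, Finset.sum_filter] at h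
      rwa [listWeight_eq_sum h2])
  rw [Finset.sum_congr rfl fun v hv => if_pos hv, ← Finset.mul_sum, hD,
    div_mul_cancel₀ _ hSpos.ne'] at hlt
  exact lt_irrefl _ hlt
end
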